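/- arXiv:1312.4513 — 3 statements merged into one kernel-verified Lean document; each statement's English description precedes it below -/
import Mathlib

section
/- For every α ∈ (0,1) and s > 0 with s ≠ 1, ∫_0^∞ e^{-sx} D_{α,1}(x) dx = (1 − s^{α−1})/(s^α − 1), where D_{α,1}(x) = ∑_{n≥1} x^{αn-1}/Γ(1+αn-1) − ∑_{n≥0} x^{αn}/Γ(1+αn). -/
open Real MeasureTheory

/-- The function D_{α,1}(x) = ∑_{n≥1} x^{αn-1}/Γ(1+αn-1) − ∑_{n≥0} x^{αn}/Γ(1+αn). -/
noncomputable def Da1 (α x : ℝ) : ℝ :=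
  (∑' n : ℕ, x ^ (α * (n + 1) - 1) / Real.Gamma (1 + α * (n + 1) - 1)) -
    ∑' n : ℕ, x ^ (α * n) / Real.Gamma (1 + α * n)

open Filter Topology

lemma aestronglyMeasurable_of_laplace_integrable {f : ℝ → ℝ} {s : ℝ}
    (hf : IntegrableOn (fun x ↦ Real.exp (-s * x) * f x) (Set.Ioi 0)) :
    AEStronglyMeasurable f (volume.restrict (Set.Ioi 0)) := by
  have h : AEStronglyMeasurable (fun x : ℝ ↦ Real.exp (s * x))
      (volume.restrict (Set.Ioi 0)) :=
    (by fun_prop : Continuous fun x : ℝ ↦ Real.exp (s * x)).aestronglyMeasurable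
  refine (h.mul hf.aestronglyMeasurable).congr (.of_forall fun x ↦ ?_)
  simp [← mul_assoc, ← Real.exp_add]

lemma norm_exp_neg_mul_ofReal (z : ℂ) (x : ℝ) :
    ‖Complex.exp (-z * x)‖ = Real.exp (-z.re * x) := by
  simp [Complex.norm_exp]

lemma integrableOn_laplace_complex {f : ℝ → ℝ} {z : ℂ}
    (hf : IntegrableOn (fun x ↦ Real.exp (-z.re * x) * f x) (Set.Ioi 0)) :
    IntegrableOn (fun x : ℝ ↦ Complex.exp (-z * x) * f x) (Set.Ioi 0) := by
  have hm := aestronglyMeasurable_of_laplace_integrable hf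
  refine Integrable.mono hf ?_ (.of_forall fun x ↦ ?_)
  · exact (by fun_prop : Continuous fun x : ℝ ↦ Complex.exp (-z * x)).aestronglyMeasurable.mul
      (Complex.continuous_ofReal.comp_aestronglyMeasurable hm)
  · simp [Complex.norm_exp]

lemma differentiableOn_laplace {f : ℝ → ℝ}
    (hf : ∀ s > 0, IntegrableOn (fun x ↦ Real.exp (-s * x) * f x) (Set.Ioi 0)) :
    DifferentiableOn ℂ (fun z : ℂ ↦ ∫ x in Set.Ioi (0 : ℝ), Complex.exp (-z * x) * f x)
      {z | 0 < z.re} := by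
  intro z hz
  have hz : 0 < z.re := hz
  set δ := z.re / 4 with hδ
  have hδ0 : 0 < δ := by positivity
  have hm := aestronglyMeasurable_of_laplace_integrable (hf 1 one_pos)
  have hmc := Complex.continuous_ofReal.comp_aestronglyMeasurable hm
  have hmeas (w : ℂ) : AEStronglyMeasurable (fun x : ℝ ↦ Complex.exp (-w * x) * f x)
      (volume.restrict (Set.Ioi 0)) :=
    (by fun_prop : Continuous fun x : ℝ ↦ Complex.exp (-w * x)).aestronglyMeasurable.mul hmc
  refine DifferentiableAt.differentiableWithinAt (HasDerivAt.differentiableAt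
    (hasDerivAt_integral_of_dominated_loc_of_deriv_le
      (F' := fun (w : ℂ) (x : ℝ) ↦ -x * (Complex.exp (-w * x) * f x))
      (bound := fun x ↦ δ⁻¹ * ‖Real.exp (-δ * x) * f x‖)
      (Metric.ball_mem_nhds z (by positivity : 0 < 2 * δ)) (.of_forall hmeas)
      (integrableOn_laplace_complex (hf _ hz)) ?_ ?_ ?_ ?_).2)
  · exact (by fun_prop : Continuous fun x : ℝ ↦ (-x : ℂ)).aestronglyMeasurable.mul (hmeas z)
  · refine ae_restrict_of_forall_mem measurableSet_Ioi fun x (hx : 0 < x) w hw ↦ ?_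
    have hw : 2 * δ < w.re := by
      have h1 := (Complex.abs_re_le_norm (w - z)).trans_lt (mem_ball_iff_norm.1 hw)
      rw [Complex.sub_re] at h1
      linarith [(abs_lt.1 h1).1]
    have hx1 : x ≤ δ⁻¹ * Real.exp (δ * x) := by
      rw [inv_mul_eq_div, le_div_iff₀ hδ0]
      linarith [Real.add_one_le_exp (δ * x)]
    have hx2 : Real.exp (-w.re * x) ≤ Real.exp (-(δ * x)) * Real.exp (-δ * x) := by
      rw [← Real.exp_add]
      gcongr
      nlinarith
    rw [norm_mul, norm_mul, norm_neg, norm_exp_neg_mul_ofReal, Complex.norm_real,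
      Complex.norm_real, norm_mul, Real.norm_of_nonneg hx.le,
      Real.norm_of_nonneg (Real.exp_pos _).le]
    calc x * (Real.exp (-w.re * x) * ‖f x‖)
        ≤ (δ⁻¹ * Real.exp (δ * x)) *
          ((Real.exp (-(δ * x)) * Real.exp (-δ * x)) * ‖f x‖) := by gcongr
      _ = δ⁻¹ * (Real.exp (-δ * x) * ‖f x‖) := by
        rw [Real.exp_neg (δ * x)]
        field_simp
  · exact (hf δ hδ0).norm.const_mul _
  · refine .of_forall fun x w _ ↦ ?_
    have h : HasDerivAt (fun w : ℂ ↦ -w * x) (-x : ℂ) w := by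
      simpa using (hasDerivAt_id w).neg.mul_const (x : ℂ)
    exact (h.cexp.mul_const (f x : ℂ)).congr_deriv (by ring)

/-- The Laplace transform is determined on the right half-plane by its values on a real
half-line. -/
lemma laplace_eq_of_eq_real {f : ℝ → ℝ} {G : ℂ → ℂ}
    (hf : ∀ s > 0, IntegrableOn (fun x ↦ Real.exp (-s * x) * f x) (Set.Ioi 0))
    (hG : DifferentiableOn ℂ G {z | 0 < z.re})
    (h : ∀ s : ℝ, 1 < s → ((∫ x in Set.Ioi (0 : ℝ), Real.exp (-s * x) * f x : ℝ) : ℂ) = G s)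
    {z : ℂ} (hz : 0 < z.re) :
    ∫ x in Set.Ioi (0 : ℝ), Complex.exp (-z * x) * f x = G z := by
  have ho : IsOpen {z : ℂ | 0 < z.re} := isOpen_lt continuous_const Complex.continuous_re
  refine ((differentiableOn_laplace hf).analyticOnNhd ho).eqOn_of_preconnected_of_frequently_eq
    (hG.analyticOnNhd ho) (convex_halfSpace_re_gt 0).isPreconnected
    (z₀ := 2) (by simp) ?_ hz
  have ht : Tendsto (fun s : ℝ ↦ (s : ℂ)) (𝓝[≠] 2) (𝓝[≠] 2) := by
    refine tendsto_nhdsWithin_iff.2 ⟨?_, ?_⟩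
    · exact (Complex.continuous_ofReal.tendsto' 2 2 (by simp)).mono_left nhdsWithin_le_nhds
    · filter_upwards [self_mem_nhdsWithin] with s hs
      simpa using fun h : (s : ℂ) = 2 ↦ hs (by exact_mod_cast h)
  refine ht.frequently (Eventually.frequently ?_)
  filter_upwards [nhdsWithin_le_nhds (lt_mem_nhds one_lt_two)] with s hs
  rw [← h s hs, ← integral_complex_ofReal]
  simp

/-- The kernel of the Riemann–Liouville fractional integral of order `a`. -/
noncomputable def fracKernel (a x : ℝ) : ℝ := x ^ (a - 1) / Real.Gamma a

lemma fracKernel_nonneg {a x : ℝ} (ha : 0 < a) (hx : 0 < x) : 0 ≤ fracKernel a x :=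
  div_nonneg (Real.rpow_nonneg hx.le _) (Real.Gamma_pos_of_pos ha).le

lemma integrableOn_exp_mul_fracKernel {a s : ℝ} (ha : 0 < a) (hs : 0 < s) :
    IntegrableOn (fun x ↦ Real.exp (-s * x) * fracKernel a x) (Set.Ioi 0) := by
  have h := (integrableOn_rpow_mul_exp_neg_mul_rpow (p := 1) (s := a - 1) (by linarith)
    one_pos hs).div_const (Real.Gamma a)
  refine h.congr (.of_forall fun x ↦ ?_)
  simp only [fracKernel, Real.rpow_one]
  ring

lemma integral_exp_mul_fracKernel {a s : ℝ} (ha : 0 < a) (hs : 0 < s) :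
    ∫ x in Set.Ioi 0, Real.exp (-s * x) * fracKernel a x = s ^ (-a) := by
  have h := Real.integral_rpow_mul_exp_neg_mul_Ioi ha hs
  have hΓ := (Real.Gamma_pos_of_pos ha).ne'
  rw [one_div, Real.inv_rpow hs.le, ← Real.rpow_neg hs.le] at h
  rw [eq_comm, ← mul_div_cancel_right₀ (s ^ (-a)) hΓ, ← h, ← integral_div]
  refine integral_congr_ae (.of_forall fun x ↦ ?_)
  simp only [fracKernel, neg_mul]
  ring

lemma differentiableOn_cpow_rightHalfPlane (b : ℂ) :
    DifferentiableOn ℂ (fun z : ℂ ↦ z ^ b) {z | 0 < z.re} := fun _ hz ↦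
  (differentiableAt_id.cpow_const (Or.inl hz)).differentiableWithinAt

lemma integral_cexp_mul_fracKernel {a : ℝ} {z : ℂ} (ha : 0 < a) (hz : 0 < z.re) :
    ∫ x in Set.Ioi (0 : ℝ), Complex.exp (-z * x) * fracKernel a x = z ^ (-a : ℂ) := by
  refine laplace_eq_of_eq_real (fun s hs ↦ integrableOn_exp_mul_fracKernel ha hs)
    (differentiableOn_cpow_rightHalfPlane _) (fun s hs ↦ ?_) hz
  rw [integral_exp_mul_fracKernel ha (by linarith), Complex.ofReal_cpow (by linarith)]
  simp

lemma norm_line_sq (c t : ℝ) : ‖(c + t * Complex.I : ℂ)‖ ^ 2 = c ^ 2 + t ^ 2 := by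
  rw [← Complex.normSq_eq_norm_sq, Complex.normSq_add_mul_I]

lemma le_norm_line (c t : ℝ) : c ≤ ‖(c + t * Complex.I : ℂ)‖ := by
  simpa using Complex.re_le_norm (c + t * Complex.I)

lemma integrable_norm_line_rpow_neg_two {c : ℝ} (hc : 0 < c) :
    Integrable fun t : ℝ ↦ ‖(c + t * Complex.I : ℂ)‖ ^ (-2 : ℝ) := by
  have h := ((integrable_inv_one_add_sq.comp_div hc.ne').const_mul (c ^ 2)⁻¹)
  refine h.congr (.of_forall fun t ↦ ?_)
  simp only
  rw [Real.rpow_neg (norm_nonneg _), Real.rpow_two, norm_line_sq, ← mul_inv]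
  congr 1
  field_simp

lemma norm_line_rpow_le {c a : ℝ} (hc : 0 < c) (ha : 2 ≤ a) (t : ℝ) :
    ‖(c + t * Complex.I : ℂ)‖ ^ (-a) ≤ c ^ (2 - a) * ‖(c + t * Complex.I : ℂ)‖ ^ (-2 : ℝ) := by
  have h := le_norm_line c t
  rw [show -a = (2 - a) + (-2) by ring, Real.rpow_add (hc.trans_le h)]
  gcongr ?_ * _
  exact Real.rpow_le_rpow_of_nonpos hc h (by linarith)

lemma line_re_pos {c : ℝ} (hc : 0 < c) (t : ℝ) : 0 < (c + t * Complex.I : ℂ).re := by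
  simpa using hc

lemma continuous_line_cpow {c : ℝ} (hc : 0 < c) (b : ℂ) :
    Continuous fun t : ℝ ↦ (c + t * Complex.I : ℂ) ^ b :=
  (by fun_prop : Continuous fun t : ℝ ↦ (c + t * Complex.I : ℂ)).cpow continuous_const
    fun t ↦ Or.inl (line_re_pos hc t)

lemma norm_cpow_neg_ofReal (z : ℂ) (a : ℝ) : ‖z ^ (-a : ℂ)‖ = ‖z‖ ^ (-a) := by
  rw [← Complex.ofReal_neg, Complex.norm_cpow_real]

lemma integrable_line_cpow {c a : ℝ} (hc : 0 < c) (ha : 2 ≤ a) :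
    Integrable fun t : ℝ ↦ (c + t * Complex.I : ℂ) ^ (-a : ℂ) :=
  Integrable.mono' ((integrable_norm_line_rpow_neg_two hc).const_mul (c ^ (2 - a)))
    (continuous_line_cpow hc _).aestronglyMeasurable
    (.of_forall fun t ↦ (norm_cpow_neg_ofReal _ _).trans_le (norm_line_rpow_le hc ha t))

open FourierTransform in
/-- The inverse Laplace transform of `z ^ (-a)`. -/
lemma integral_line_cexp_mul_cpow {c a x : ℝ} (hc : 0 < c) (ha : 2 ≤ a) (hx : 0 < x) :
    ∫ t : ℝ, Complex.exp ((c + t * Complex.I) * x) * (c + t * Complex.I : ℂ) ^ (-a : ℂ) =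
      2 * π * fracKernel a x := by
  have ha0 : 0 < a := by linarith
  let f : ℝ → ℂ := fun y ↦ (Real.exp (-c * y) * ((max y 0) ^ (a - 1) / Real.Gamma a) : ℝ)
  have hf_eq : f = (Set.Ioi (0 : ℝ)).indicator
      fun y ↦ ((Real.exp (-c * y) * fracKernel a y : ℝ) : ℂ) := by
    ext y
    by_cases hy : 0 < y
    · simp [f, fracKernel, hy, hy.le]
    · have hy' : max y 0 = 0 := max_eq_right (not_lt.1 hy)
      simp [f, hy, hy', Real.zero_rpow (by linarith : a - 1 ≠ 0)]
  have hfc : Continuous f := by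
    have : Continuous fun y : ℝ ↦ (max y 0) ^ (a - 1) :=
      (by fun_prop : Continuous fun y : ℝ ↦ max y 0).rpow_const fun y ↦ Or.inr (by linarith)
    fun_prop
  have hfi : Integrable f := by
    rw [hf_eq, integrable_indicator_iff measurableSet_Ioi]
    exact (integrableOn_exp_mul_fracKernel ha0 hc).ofReal
  have hF : 𝓕 f = fun ξ : ℝ ↦ (c + (2 * π * ξ : ℝ) * Complex.I : ℂ) ^ (-a : ℂ) := by
    ext ξ
    rw [Real.fourier_eq', ← integral_cexp_mul_fracKernel ha0 (line_re_pos hc _),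
      ← integral_indicator measurableSet_Ioi]
    refine integral_congr_ae (.of_forall fun y ↦ ?_)
    simp only [hf_eq]
    by_cases hy : 0 < y
    · simp only [Set.indicator_of_mem (Set.mem_Ioi.2 hy)]
      push_cast
      rw [smul_eq_mul, ← mul_assoc, ← Complex.exp_add]
      congr 2
      simp
      ring
    · simp [hy]
  have hFi : Integrable (𝓕 f) := by
    rw [hF]
    exact (integrable_line_cpow hc ha).comp_mul_left' (by positivity : 2 * π ≠ 0)
  have h := congrFun (hfc.fourierInv_fourier_eq hfi hFi) x
  rw [Real.fourierInv_eq', hF] at h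
  have h2 := Measure.integral_comp_mul_left (fun t : ℝ ↦ Complex.exp (t * x * Complex.I) *
    (c + t * Complex.I : ℂ) ^ (-a : ℂ)) (2 * π)
  have h3 : ∫ ξ : ℝ, Complex.exp ((2 * π * ξ : ℝ) * x * Complex.I) *
      (c + (2 * π * ξ : ℝ) * Complex.I : ℂ) ^ (-a : ℂ) = f x := by
    rw [← h]
    refine integral_congr_ae (.of_forall fun ξ ↦ ?_)
    simp only [smul_eq_mul]
    congr 2
    simp
    ring
  rw [h3, abs_of_pos (by positivity)] at h2
  have h4 : ∫ t : ℝ, Complex.exp (t * x * Complex.I) * (c + t * Complex.I : ℂ) ^ (-a : ℂ) =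
      2 * π * f x := by
    have hπ : (2 * π : ℂ) ≠ 0 := by exact_mod_cast (by positivity : (2 * π : ℝ) ≠ 0)
    rw [h2, Complex.real_smul, ← mul_assoc]
    push_cast
    rw [mul_inv_cancel₀ hπ, one_mul]
  calc _ = ∫ t : ℝ, Complex.exp (c * x) *
        (Complex.exp (t * x * Complex.I) * (c + t * Complex.I : ℂ) ^ (-a : ℂ)) := by
        refine integral_congr_ae (.of_forall fun t ↦ ?_)
        simp only
        rw [← mul_assoc, ← Complex.exp_add]
        congr 2
        ring
    _ = _ := by
        rw [integral_const_mul, h4, hf_eq, Set.indicator_of_mem (Set.mem_Ioi.2 hx)]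
        push_cast
        have : Complex.exp (c * x) * Complex.exp (-c * x) = 1 := by
          rw [← Complex.exp_add]
          simp
        linear_combination (2 * π * fracKernel a x : ℂ) * this

lemma hasSum_fracKernel {a α c x : ℝ} (ha : 2 ≤ a) (hα : 0 < α) (hc : 1 < c) (hx : 0 < x) :
    HasSum (fun n : ℕ ↦ (2 * π * fracKernel (a + α * n) x : ℂ))
      (∫ t : ℝ, Complex.exp ((c + t * Complex.I) * x) *
        ((c + t * Complex.I : ℂ) ^ (-a : ℂ) / (1 - (c + t * Complex.I : ℂ) ^ (-α : ℂ)))) := by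
  have hc0 : 0 < c := by linarith
  have han (n : ℕ) : 2 ≤ a + α * n := by
    have : 0 ≤ α * n := by positivity
    linarith
  set F : ℕ → ℝ → ℂ := fun n t ↦ Complex.exp ((c + t * Complex.I) * x) *
    (c + t * Complex.I : ℂ) ^ (-(a + α * n : ℝ) : ℂ) with hF
  have hexp (t : ℝ) : ‖Complex.exp ((c + t * Complex.I) * x)‖ = Real.exp (c * x) := by
    simp [Complex.norm_exp]
  have hFi (n : ℕ) : Integrable (F n) :=
    (integrable_line_cpow hc0 (han n)).bdd_mul
      (by fun_prop : Continuous fun t : ℝ ↦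
        Complex.exp ((c + t * Complex.I) * x)).aestronglyMeasurable
      (.of_forall fun t ↦ (hexp t).le)
  have hr : c ^ (-α) < 1 := Real.rpow_lt_one_of_one_lt_of_neg hc (by linarith)
  have hFs : Summable fun n ↦ ∫ t, ‖F n t‖ := by
    set B := ∫ t : ℝ, ‖(c + t * Complex.I : ℂ)‖ ^ (-2 : ℝ)
    refine Summable.of_nonneg_of_le (f := fun n : ℕ ↦
      (Real.exp (c * x) * c ^ (2 - a) * B) * (c ^ (-α)) ^ n)
      (fun n ↦ integral_nonneg fun t ↦ norm_nonneg _) (fun n ↦ ?_)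
      ((summable_geometric_of_lt_one (by positivity) hr).mul_left _)
    calc ∫ t, ‖F n t‖
        ≤ ∫ t : ℝ, (Real.exp (c * x) * c ^ (2 - (a + α * n))) *
            ‖(c + t * Complex.I : ℂ)‖ ^ (-2 : ℝ) := by
          refine integral_mono (hFi n).norm
            ((integrable_norm_line_rpow_neg_two hc0).const_mul _) fun t ↦ ?_
          simp only [hF]
          rw [norm_mul, hexp, norm_cpow_neg_ofReal, mul_assoc]
          gcongr
          exact norm_line_rpow_le hc0 (han n) t
      _ = _ := by
          rw [integral_const_mul, show 2 - (a + α * n) = (2 - a) + (-α) * n by ring,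
            Real.rpow_add hc0, Real.rpow_mul hc0.le, Real.rpow_natCast]
          ring
  have hterm : (fun n : ℕ ↦ (2 * π * fracKernel (a + α * n) x : ℂ)) = fun n ↦ ∫ t, F n t := by
    ext n
    rw [hF, integral_line_cexp_mul_cpow hc0 (han n) hx]
  have hlim : ∫ t : ℝ, Complex.exp ((c + t * Complex.I) * x) *
      ((c + t * Complex.I : ℂ) ^ (-a : ℂ) / (1 - (c + t * Complex.I : ℂ) ^ (-α : ℂ))) =
      ∫ t, ∑' n, F n t := by
    refine integral_congr_ae (.of_forall fun t ↦ ?_)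
    simp only [hF]
    have hz0 : (c + t * Complex.I : ℂ) ≠ 0 := fun h ↦ by
      simpa [h] using line_re_pos hc0 t
    have hzn : ‖(c + t * Complex.I : ℂ) ^ (-α : ℂ)‖ < 1 := by
      rw [norm_cpow_neg_ofReal]
      exact (Real.rpow_le_rpow_of_nonpos hc0 (le_norm_line c t) (by linarith)).trans_lt hr
    rw [tsum_mul_left, div_eq_mul_inv, ← tsum_geometric_of_norm_lt_one hzn, ← tsum_mul_left]
    congr 2
    ext n
    rw [← Complex.cpow_mul_nat, ← Complex.cpow_add _ _ hz0]
    congr 1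
    push_cast
    ring
  rw [hterm, hlim]
  exact hasSum_integral_of_summable_integral_norm hFi hFs

/-- Vertical contours of integration may be shifted under inverse-square decay. -/
lemma integral_vertical_line_eq {f : ℂ → ℂ} {a b C : ℝ} (ha : 0 < a) (hab : a ≤ b)
    (hf : DifferentiableOn ℂ f {z | 0 < z.re})
    (hbd : ∀ z : ℂ, a ≤ z.re → z.re ≤ b → ‖f z‖ ≤ C * ‖z‖ ^ (-2 : ℝ)) :
    ∫ t : ℝ, f (a + t * Complex.I) = ∫ t : ℝ, f (b + t * Complex.I) := by
  have hint (c : ℝ) (hac : a ≤ c) (hcb : c ≤ b) : Integrable fun t : ℝ ↦ f (c + t * Complex.I) := by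
    have hc0 := ha.trans_le hac
    refine Integrable.mono' ((integrable_norm_line_rpow_neg_two hc0).const_mul C) ?_
      (.of_forall fun t ↦ hbd _ (by simpa using hac) (by simpa using hcb))
    exact (hf.continuousOn.comp_continuous (by fun_prop) fun t ↦
      line_re_pos hc0 t).aestronglyMeasurable
  have hC : 0 ≤ C := by
    have h := (norm_nonneg _).trans (hbd a (by simp) (by simpa using hab))
    exact nonneg_of_mul_nonneg_left h
      (Real.rpow_pos_of_pos (norm_pos_iff.2 (by exact_mod_cast ha.ne')) _)
  have hv (c : ℝ) (hac : a ≤ c) (hcb : c ≤ b) :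
      Tendsto (fun T : ℝ ↦ ∫ t in (-T)..T, f (c + t * Complex.I)) atTop
        (𝓝 (∫ t : ℝ, f (c + t * Complex.I))) :=
    intervalIntegral_tendsto_integral (hint c hac hcb) tendsto_neg_atTop_atBot tendsto_id
  have hh (σ : ℝ) (hσ : |σ| = 1) :
      Tendsto (fun T : ℝ ↦ ∫ u in a..b, f (u + (σ * T : ℝ) * Complex.I)) atTop (𝓝 0) := by
    have hlim : Tendsto (fun T : ℝ ↦ C * T ^ (-2 : ℝ) * |b - a|) atTop (𝓝 0) := by
      simpa using ((tendsto_rpow_neg_atTop (by norm_num : (0 : ℝ) < 2)).const_mul C).mul_const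
        |b - a|
    refine squeeze_zero_norm' ?_ hlim
    filter_upwards [eventually_gt_atTop 0] with T hT
    refine intervalIntegral.norm_integral_le_of_norm_le_const fun u hu ↦ ?_
    rw [Set.uIoc_of_le hab] at hu
    refine (hbd _ (by simpa using hu.1.le) (by simpa using hu.2)).trans ?_
    refine mul_le_mul_of_nonneg_left ?_ hC
    refine Real.rpow_le_rpow_of_nonpos hT ?_ (by norm_num)
    have h := Complex.abs_im_le_norm (u + (σ * T : ℝ) * Complex.I)
    simpa [abs_mul, hσ, abs_of_pos hT] using h
  have hrect (T : ℝ) := Complex.integral_boundary_rect_eq_zero_of_differentiableOn f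
    (a + (-T : ℝ) * Complex.I) (b + T * Complex.I) (hf.mono fun z hz ↦ by
      have h := (Complex.mem_reProdIm.1 hz).1
      simp only [Complex.add_re, Complex.ofReal_re, Complex.mul_re, Complex.I_re, mul_zero,
        Complex.ofReal_im, Complex.I_im, mul_one, sub_self, add_zero, Set.uIcc_of_le hab] at h
      exact ha.trans_le h.1)
  simp only [Complex.add_re, Complex.ofReal_re, Complex.mul_re, Complex.I_re, mul_zero,
    Complex.ofReal_im, Complex.I_im, mul_one, sub_self, add_zero, Complex.add_im, Complex.mul_im,
    zero_add] at hrect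
  have h1 := hh (-1) (by simp)
  have h2 := hh 1 (by simp)
  simp only [neg_mul, one_mul] at h1 h2
  have hlim := ((h1.sub h2).add ((hv b hab le_rfl).const_smul Complex.I)).sub
    ((hv a le_rfl hab).const_smul Complex.I)
  have h0 := tendsto_nhds_unique (hlim.congr hrect) tendsto_const_nhds
  rw [sub_zero, zero_add, ← smul_sub, smul_eq_zero_iff_right Complex.I_ne_zero, sub_eq_zero] at h0
  exact h0.symm

/-- The analytic continuation of `(1 - z ^ (α - 1)) / (z ^ α - 1)` to the right half-plane. -/
noncomputable def laplaceDa1 (α : ℝ) (z : ℂ) : ℂ :=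
  z⁻¹ * ((dslope (fun w : ℂ ↦ w ^ (α : ℂ)) 1 z)⁻¹ - 1)

lemma cpow_sub_one_ne_zero {α : ℝ} (hα : α ∈ Set.Ioo (0 : ℝ) 1) {z : ℂ} (hz : 0 < z.re)
    (hz1 : z ≠ 1) : z ^ (α : ℂ) - 1 ≠ 0 := by
  intro h
  refine hz1 ?_
  have hlog : (Complex.log z * α).im = z.arg * α := by simp [Complex.log_im]
  have harg := abs_lt.1 (Complex.abs_arg_lt_pi_div_two_iff.2 (Or.inl hz))
  have hα0 : (α : ℂ) ≠ 0 := by exact_mod_cast hα.1.ne'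
  have hpow := Complex.cpow_mul (x := z) (y := α) (α : ℂ)⁻¹
    (by rw [hlog]; nlinarith [hα.1, hα.2, Real.pi_pos])
    (by rw [hlog]; nlinarith [hα.1, hα.2, Real.pi_pos])
  rwa [mul_inv_cancel₀ hα0, Complex.cpow_one, sub_eq_zero.1 h, Complex.one_cpow] at hpow

lemma laplaceDa1_eq {α : ℝ} (hα : α ∈ Set.Ioo (0 : ℝ) 1) {z : ℂ} (hz : 0 < z.re)
    (hz1 : z ≠ 1) :
    laplaceDa1 α z = (1 - z ^ ((α - 1 : ℝ) : ℂ)) / (z ^ (α : ℂ) - 1) := by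
  have hz0 : z ≠ 0 := fun h ↦ by simp [h] at hz
  have h1 := cpow_sub_one_ne_zero hα hz hz1
  have h2 := sub_ne_zero.2 hz1
  rw [laplaceDa1, dslope_of_ne _ hz1, slope_def_field, Complex.one_cpow]
  push_cast
  rw [Complex.cpow_sub _ _ hz0, Complex.cpow_one]
  field_simp
  ring

lemma differentiableOn_laplaceDa1 {α : ℝ} (hα : α ∈ Set.Ioo (0 : ℝ) 1) :
    DifferentiableOn ℂ (laplaceDa1 α) {z | 0 < z.re} := by
  have ho : IsOpen {z : ℂ | 0 < z.re} := isOpen_lt continuous_const Complex.continuous_re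
  have hd := (Complex.differentiableOn_dslope (ho.mem_nhds (by simp : (1 : ℂ) ∈ _))).2
    (differentiableOn_cpow_rightHalfPlane α)
  refine (differentiableOn_id.inv fun z hz h ↦ ?_).mul ((hd.inv fun z hz ↦ ?_).sub_const 1)
  · simp [show z = 0 from h] at hz
  · by_cases hz1 : z = 1
    · rw [hz1, dslope_same]
      have h : HasDerivAt (fun w : ℂ ↦ w ^ (α : ℂ)) α 1 := by
        simpa using (hasDerivAt_id (1 : ℂ)).cpow_const (c := (α : ℂ)) (by simp)
      rw [h.deriv]
      exact_mod_cast hα.1.ne'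
    · rw [dslope_of_ne _ hz1, slope_def_field, Complex.one_cpow]
      exact div_ne_zero (cpow_sub_one_ne_zero hα hz hz1) (sub_ne_zero.2 hz1)

lemma exists_norm_laplaceDa1_le {α : ℝ} (hα : α ∈ Set.Ioo (0 : ℝ) 1) {a : ℝ} (ha : 0 < a) :
    ∃ C, ∀ z : ℂ, a ≤ z.re → ‖laplaceDa1 α z‖ ≤ C := by
  set M : ℝ := 2 ^ α⁻¹
  have hM : 1 ≤ M := Real.one_le_rpow one_le_two (inv_nonneg.2 hα.1.le)
  have hK : IsCompact ({z : ℂ | a ≤ z.re} ∩ Metric.closedBall 0 M) :=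
    (isCompact_closedBall 0 M).inter_left (isClosed_le continuous_const Complex.continuous_re)
  obtain ⟨C, hC⟩ := hK.exists_bound_of_continuousOn
    ((differentiableOn_laplaceDa1 hα).continuousOn.mono fun z hz ↦ ha.trans_le hz.1)
  refine ⟨max C 2, fun z hza ↦ ?_⟩
  have hz := ha.trans_le hza
  by_cases hzM : ‖z‖ ≤ M
  · exact (hC z ⟨hza, by simpa using hzM⟩).trans (le_max_left _ _)
  refine le_trans ?_ (le_max_right _ _)
  push Not at hzM
  have hz1 : z ≠ 1 := fun h ↦ by simp [h] at hzM; linarith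
  rw [laplaceDa1_eq hα hz hz1, norm_div]
  have h1 : ‖z ^ ((α - 1 : ℝ) : ℂ)‖ ≤ 1 := by
    rw [Complex.norm_cpow_real]
    exact Real.rpow_le_one_of_one_le_of_nonpos (hM.trans hzM.le) (by linarith [hα.2])
  have h2 : 2 ≤ ‖z ^ (α : ℂ)‖ := by
    rw [Complex.norm_cpow_real]
    calc (2 : ℝ) = M ^ α := by
          rw [← Real.rpow_mul zero_le_two, inv_mul_cancel₀ hα.1.ne', Real.rpow_one]
      _ ≤ _ := Real.rpow_le_rpow (by linarith) hzM.le hα.1.le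
  have h3 : ‖1 - z ^ ((α - 1 : ℝ) : ℂ)‖ ≤ 2 :=
    (norm_sub_le _ _).trans (by rw [norm_one]; linarith)
  have h4 : 1 ≤ ‖z ^ (α : ℂ) - 1‖ := by
    have := norm_sub_norm_le (z ^ (α : ℂ)) 1
    rw [norm_one] at this
    linarith
  rw [div_le_iff₀ (by linarith)]
  linarith

/-- The `n`-th term of the series defining `Da1`. -/
noncomputable def da1Term (α : ℝ) (n : ℕ) (x : ℝ) : ℝ :=
  fracKernel (α * (n + 1)) x - fracKernel (1 + α * n) x

lemma summable_fracKernel {a α x : ℝ} (hα : 0 < α) (hx : 0 < x) :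
    Summable fun n : ℕ ↦ fracKernel (a + α * n) x := by
  obtain ⟨N, hN⟩ := exists_nat_ge ((2 - a) / α)
  rw [div_le_iff₀ hα] at hN
  have h := (hasSum_fracKernel (a := a + α * N) (c := 2) (by linarith) hα one_lt_two hx).summable
  rw [← summable_nat_add_iff N]
  have h' : Summable fun n : ℕ ↦ 2 * π * fracKernel (a + α * N + α * n) x := by
    exact_mod_cast h
  refine ((summable_mul_left_iff (by positivity : 2 * π ≠ 0)).1 h').congr fun n ↦ ?_
  push_cast
  ring_nf

lemma hasSum_da1Term {α x : ℝ} (hα : 0 < α) (hx : 0 < x) :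
    HasSum (fun n ↦ da1Term α n x) (Da1 α x) := by
  have h1 := (summable_fracKernel (a := α) hα hx).hasSum
  have h2 := (summable_fracKernel (a := 1) hα hx).hasSum
  have hterm : (fun n ↦ da1Term α n x) =
      fun n : ℕ ↦ fracKernel (α + α * n) x - fracKernel (1 + α * n) x := by
    ext n
    rw [da1Term, mul_add_one, add_comm α]
  have hD : Da1 α x =
      ∑' n : ℕ, fracKernel (α + α * n) x - ∑' n : ℕ, fracKernel (1 + α * n) x := by
    simp only [Da1, fracKernel]
    congr 3 <;> ext n <;> ring_nf
  rw [hterm, hD]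
  exact h1.sub h2

lemma one_sub_cpow_neg_ne_zero {α : ℝ} (hα : α ∈ Set.Ioo (0 : ℝ) 1) {z : ℂ} (hz : 0 < z.re)
    (hz1 : z ≠ 1) : 1 - z ^ (-α : ℂ) ≠ 0 := by
  intro h
  have h1 : z ^ (-α : ℂ) = 1 := (sub_eq_zero.1 h).symm
  rw [Complex.cpow_neg, inv_eq_one] at h1
  exact cpow_sub_one_ne_zero hα hz hz1 (sub_eq_zero.2 h1)

lemma integrable_line_cexp_mul_cpow_div {a α c : ℝ} (ha : 2 ≤ a) (hα : α ∈ Set.Ioo (0 : ℝ) 1)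
    (hc : 1 < c) (x : ℝ) :
    Integrable fun t : ℝ ↦ Complex.exp ((c + t * Complex.I) * x) *
      ((c + t * Complex.I : ℂ) ^ (-a : ℂ) / (1 - (c + t * Complex.I : ℂ) ^ (-α : ℂ))) := by
  have hc0 : 0 < c := by linarith
  have hr : c ^ (-α) < 1 := Real.rpow_lt_one_of_one_lt_of_neg hc (by linarith [hα.1])
  have hne (t : ℝ) : 1 - (c + t * Complex.I : ℂ) ^ (-α : ℂ) ≠ 0 :=
    one_sub_cpow_neg_ne_zero hα (line_re_pos hc0 t) fun h ↦ by
      have := congrArg Complex.re h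
      simp at this
      linarith
  have hcont : Continuous fun t : ℝ ↦ Complex.exp ((c + t * Complex.I) * x) /
      (1 - (c + t * Complex.I : ℂ) ^ (-α : ℂ)) :=
    (by fun_prop : Continuous fun t : ℝ ↦ Complex.exp ((c + t * Complex.I) * x)).div
      (continuous_const.sub (continuous_line_cpow hc0 _)) hne
  refine ((integrable_line_cpow hc0 ha).bdd_mul (c := Real.exp (c * x) / (1 - c ^ (-α)))
    hcont.aestronglyMeasurable (.of_forall fun t ↦ ?_)).congr (.of_forall fun t ↦ by ring)
  have h1 : 1 - c ^ (-α) ≤ ‖1 - (c + t * Complex.I : ℂ) ^ (-α : ℂ)‖ := by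
    have h := norm_sub_norm_le 1 ((c + t * Complex.I : ℂ) ^ (-α : ℂ))
    rw [norm_one, norm_cpow_neg_ofReal] at h
    have := Real.rpow_le_rpow_of_nonpos hc0 (le_norm_line c t) (by linarith [hα.1] : -α ≤ 0)
    linarith
  rw [norm_div, Complex.norm_exp]
  simp only [Complex.mul_re, Complex.add_re, Complex.ofReal_re, Complex.I_re, Complex.ofReal_im,
    Complex.I_im, mul_zero, sub_zero, add_zero, mul_one, sub_self]
  exact div_le_div_of_nonneg_left (Real.exp_pos _).le (by linarith) h1

/-- Away from finitely many terms of its series, `Da1` has an integral representation on every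
vertical line in the right half-plane. -/
lemma integral_line_laplaceDa1 {α : ℝ} (hα : α ∈ Set.Ioo (0 : ℝ) 1) {N : ℕ} (hN : 2 ≤ α * N)
    {ε x : ℝ} (hε : 0 < ε) (hε2 : ε ≤ 2) (hx : 0 < x) :
    ∫ t : ℝ, Complex.exp ((ε + t * Complex.I) * x) *
      ((ε + t * Complex.I : ℂ) ^ (-(α * N : ℝ) : ℂ) * laplaceDa1 α (ε + t * Complex.I)) =
      2 * π * ((Da1 α x - ∑ n ∈ Finset.range N, da1Term α n x : ℝ) : ℂ) := by
  have hα0 := hα.1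
  obtain ⟨C, hC⟩ := exists_norm_laplaceDa1_le hα hε
  have hshift := integral_vertical_line_eq (C := Real.exp (2 * x) * (ε ^ (2 - α * N) * C))
    (f := fun z ↦ Complex.exp (z * x) * (z ^ (-(α * N : ℝ) : ℂ) * laplaceDa1 α z)) hε hε2
    ((by fun_prop : Differentiable ℂ fun z : ℂ ↦ Complex.exp (z * x)).differentiableOn.mul
      ((differentiableOn_cpow_rightHalfPlane _).mul (differentiableOn_laplaceDa1 hα)))
    fun z hz1 hz2 ↦ by
      have h1 : ‖z‖ ^ (-(α * N)) ≤ ε ^ (2 - α * N) * ‖z‖ ^ (-2 : ℝ) := by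
        have hz : ε ≤ ‖z‖ := hz1.trans (Complex.re_le_norm z)
        rw [show -(α * N) = (2 - α * N) + (-2) by ring, Real.rpow_add (hε.trans_le hz)]
        gcongr ?_ * _
        exact Real.rpow_le_rpow_of_nonpos hε hz (by linarith)
      rw [norm_mul, norm_mul, norm_cpow_neg_ofReal, Complex.norm_exp]
      calc Real.exp (z * x).re * (‖z‖ ^ (-(α * N)) * ‖laplaceDa1 α z‖)
          ≤ Real.exp (2 * x) * ((ε ^ (2 - α * N) * ‖z‖ ^ (-2 : ℝ)) * C) := by
            gcongr
            · simp only [Complex.re_mul_ofReal]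
              gcongr
            · exact hC z hz1
        _ = _ := by ring
  have ha1 : 2 ≤ α * N + α := by linarith
  have ha2 : 2 ≤ α * N + 1 := by linarith
  have h1 := hasSum_fracKernel ha1 hα0 one_lt_two hx
  have h2 := hasSum_fracKernel ha2 hα0 one_lt_two hx
  have h12 := h1.sub h2
  rw [← integral_sub (integrable_line_cexp_mul_cpow_div ha1 hα one_lt_two x)
    (integrable_line_cexp_mul_cpow_div ha2 hα one_lt_two x)] at h12
  have htail := (hasSum_nat_add_iff' N).2 (hasSum_da1Term hα0 hx)
  have htailc := (Complex.hasSum_ofReal.2 htail).mul_left (2 * π : ℂ)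
  have hfun (n : ℕ) : (2 * π * da1Term α (n + N) x : ℂ) =
      2 * π * fracKernel (α * N + α + α * n) x - 2 * π * fracKernel (α * N + 1 + α * n) x := by
    rw [da1Term]
    push_cast
    ring_nf
  simp only [hfun] at htailc
  rw [hshift, htailc.unique h12]
  refine integral_congr_ae (.of_forall fun t ↦ ?_)
  simp only
  have hre := line_re_pos two_pos t
  have hz1 : ((2 : ℝ) + t * Complex.I : ℂ) ≠ 1 := fun h ↦ by
    have := congrArg Complex.re h
    norm_num at this
  generalize ((2 : ℝ) + t * Complex.I : ℂ) = z at hre hz1 ⊢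
  have hz0 : z ≠ 0 := fun h ↦ by simp [h] at hre
  have h3 := cpow_sub_one_ne_zero hα hre hz1
  have h4 := one_sub_cpow_neg_ne_zero hα hre hz1
  have h5 : z ^ (α : ℂ) ≠ 0 := by simp [Complex.cpow_eq_zero_iff, hz0]
  rw [← mul_sub, laplaceDa1_eq hα hre hz1]
  congr 1
  push_cast
  rw [neg_add, neg_add, Complex.cpow_add _ _ hz0, Complex.cpow_add _ _ hz0,
    Complex.cpow_sub _ _ hz0, Complex.cpow_neg_one, Complex.cpow_one]
  rw [Complex.cpow_neg z α] at h4 ⊢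
  have h6 : 1 - (z ^ (α : ℂ))⁻¹ = (z ^ (α : ℂ) - 1) / z ^ (α : ℂ) := by field_simp
  rw [h6]
  field_simp

lemma exists_abs_da1_tail_le {α : ℝ} (hα : α ∈ Set.Ioo (0 : ℝ) 1) {N : ℕ} (hN : 2 ≤ α * N)
    {ε : ℝ} (hε : 0 < ε) (hε2 : ε ≤ 2) :
    ∃ C, ∀ x > 0, |Da1 α x - ∑ n ∈ Finset.range N, da1Term α n x| ≤ C * Real.exp (ε * x) := by
  obtain ⟨C, hC⟩ := exists_norm_laplaceDa1_le hα hε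
  set B := ∫ t : ℝ, ‖(ε + t * Complex.I : ℂ)‖ ^ (-2 : ℝ) * (ε ^ (2 - α * N) * C)
  refine ⟨(2 * π)⁻¹ * B, fun x hx ↦ ?_⟩
  have h := congrArg norm (integral_line_laplaceDa1 hα hN hε hε2 hx)
  rw [norm_mul, Complex.norm_real, Real.norm_eq_abs] at h
  have h2π : ‖(2 * π : ℂ)‖ = 2 * π := by
    simp [abs_of_pos Real.pi_pos]
  rw [h2π] at h
  rw [mul_assoc, ← mul_le_mul_iff_of_pos_left (by positivity : 0 < 2 * π),
    mul_inv_cancel_left₀ (by positivity), ← h, mul_comm B, ← integral_const_mul]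
  refine norm_integral_le_of_norm_le
    (((integrable_norm_line_rpow_neg_two hε).mul_const _).const_mul _) (.of_forall fun t ↦ ?_)
  have hbd := norm_line_rpow_le hε hN t
  have hCt := hC _ (by simp : ε ≤ (ε + t * Complex.I : ℂ).re)
  have hexp : ((ε + t * Complex.I) * x : ℂ).re = ε * x := by simp
  rw [norm_mul, norm_mul, norm_cpow_neg_ofReal, Complex.norm_exp, hexp]
  refine mul_le_mul_of_nonneg_left ?_ (Real.exp_pos _).le
  calc _ ≤ (ε ^ (2 - α * N) * ‖(ε + t * Complex.I : ℂ)‖ ^ (-2 : ℝ)) * C := by gcongr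
    _ = _ := by ring

lemma integrableOn_exp_mul_da1Term {α s : ℝ} (hα : 0 < α) (hs : 0 < s) (n : ℕ) :
    IntegrableOn (fun x ↦ Real.exp (-s * x) * da1Term α n x) (Set.Ioi 0) := by
  simp only [da1Term, mul_sub]
  exact (integrableOn_exp_mul_fracKernel (by positivity) hs).sub
    (integrableOn_exp_mul_fracKernel (by positivity) hs)

lemma integrableOn_exp_mul_Da1 {α s : ℝ} (hα : α ∈ Set.Ioo (0 : ℝ) 1) (hs : 0 < s) :
    IntegrableOn (fun x ↦ Real.exp (-s * x) * Da1 α x) (Set.Ioi 0) := by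
  have hα0 := hα.1
  obtain ⟨N, hN⟩ := exists_nat_ge (2 / α)
  rw [div_le_iff₀' hα0] at hN
  set ε := min (s / 2) 2
  have hε : 0 < ε := by positivity
  obtain ⟨C, hC⟩ := exists_abs_da1_tail_le hα hN hε (min_le_right _ _)
  have hpart (M : ℕ) : IntegrableOn
      (fun x ↦ Real.exp (-s * x) * ∑ n ∈ Finset.range M, da1Term α n x) (Set.Ioi 0) := by
    simp only [Finset.mul_sum]
    exact integrable_finsetSum _ fun n _ ↦ integrableOn_exp_mul_da1Term hα0 hs n
  have hmeas : AEStronglyMeasurable (fun x ↦ Real.exp (-s * x) * Da1 α x)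
      (volume.restrict (Set.Ioi 0)) :=
    aestronglyMeasurable_of_tendsto_ae atTop (fun M ↦ (hpart M).aestronglyMeasurable)
      (ae_restrict_of_forall_mem measurableSet_Ioi fun x hx ↦
        (hasSum_da1Term hα0 hx).tendsto_sum_nat.const_mul _)
  have htail : IntegrableOn (fun x ↦ Real.exp (-s * x) * Da1 α x -
      Real.exp (-s * x) * ∑ n ∈ Finset.range N, da1Term α n x) (Set.Ioi 0) := by
    have hexp : IntegrableOn (fun x ↦ C * Real.exp (-(s - ε) * x)) (Set.Ioi 0) :=
      (exp_neg_integrableOn_Ioi 0 (by linarith [min_le_left (s / 2) 2])).const_mul C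
    refine hexp.mono' (hmeas.sub (hpart N).aestronglyMeasurable)
      (ae_restrict_of_forall_mem measurableSet_Ioi fun x hx ↦ ?_)
    rw [← mul_sub, norm_mul, Real.norm_of_nonneg (Real.exp_pos _).le, Real.norm_eq_abs]
    calc _ ≤ Real.exp (-s * x) * (C * Real.exp (ε * x)) := by
          gcongr
          exact hC x hx
      _ = C * Real.exp (-(s - ε) * x) := by
          rw [mul_left_comm, ← Real.exp_add]
          ring_nf
  exact (htail.add (hpart N)).congr (.of_forall fun x ↦ by simp)

lemma laplaceDa1_ofReal {α s : ℝ} (hα : α ∈ Set.Ioo (0 : ℝ) 1) (hs : 0 < s) (hs1 : s ≠ 1) :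
    laplaceDa1 α s = ((1 - s ^ (α - 1)) / (s ^ α - 1) : ℝ) := by
  rw [laplaceDa1_eq hα (by simpa using hs) (by exact_mod_cast hs1)]
  push_cast [Complex.ofReal_cpow hs.le]
  rfl

lemma laplace_Da1_of_one_lt {α s : ℝ} (hα : α ∈ Set.Ioo (0 : ℝ) 1) (hs : 1 < s) :
    ∫ x in Set.Ioi (0 : ℝ), Real.exp (-s * x) * Da1 α x = (1 - s ^ (α - 1)) / (s ^ α - 1) := by
  have hα0 := hα.1
  have hs0 : 0 < s := by linarith
  have hr : s ^ (-α) < 1 := Real.rpow_lt_one_of_one_lt_of_neg hs (by linarith)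
  have hint (a : ℝ) (ha : 0 < a) (n : ℕ) :
      ∫ x in Set.Ioi 0, Real.exp (-s * x) * fracKernel (a + α * n) x =
        s ^ (-a) * (s ^ (-α)) ^ n := by
    rw [integral_exp_mul_fracKernel (by positivity) hs0, neg_add, Real.rpow_add hs0, ← neg_mul,
      Real.rpow_mul hs0.le, Real.rpow_natCast]
  have hgeom (a : ℝ) : HasSum (fun n : ℕ ↦ s ^ (-a) * (s ^ (-α)) ^ n)
      (s ^ (-a) * (1 - s ^ (-α))⁻¹) :=
    (hasSum_geometric_of_lt_one (by positivity) hr).mul_left _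
  have hki (a : ℝ) (ha : 0 < a) (n : ℕ) := integrableOn_exp_mul_fracKernel
    (by positivity : 0 < a + α * n) hs0
  have hterm (n : ℕ) (x : ℝ) : Real.exp (-s * x) * da1Term α n x =
      Real.exp (-s * x) * fracKernel (α + α * n) x -
        Real.exp (-s * x) * fracKernel (1 + α * n) x := by
    rw [da1Term, mul_add_one, add_comm α, mul_sub]
  have hnn (a : ℝ) (ha : 0 < a) (n : ℕ) (x : ℝ) (hx : 0 < x) :
      0 ≤ Real.exp (-s * x) * fracKernel (a + α * n) x :=
    mul_nonneg (Real.exp_pos _).le (fracKernel_nonneg (by positivity) hx)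
  have hsum := hasSum_integral_of_summable_integral_norm
    (F := fun n x ↦ Real.exp (-s * x) * da1Term α n x)
    (fun n ↦ integrableOn_exp_mul_da1Term hα0 hs0 n) (Summable.of_nonneg_of_le
      (fun n ↦ integral_nonneg fun x ↦ norm_nonneg _) (fun n ↦ ?_)
      ((hgeom α).add (hgeom 1)).summable)
  · have hval := (hgeom α).sub (hgeom 1)
    have hI : (fun n ↦ ∫ x in Set.Ioi 0, Real.exp (-s * x) * da1Term α n x) =
        fun n ↦ s ^ (-α) * (s ^ (-α)) ^ n - s ^ (-1 : ℝ) * (s ^ (-α)) ^ n := by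
      ext n
      simp only [hterm]
      rw [integral_sub (hki α hα0 n) (hki 1 one_pos n), hint α hα0, hint 1 one_pos]
    rw [hI] at hsum
    have hD : ∫ x in Set.Ioi (0 : ℝ), Real.exp (-s * x) * Da1 α x =
        ∫ x in Set.Ioi (0 : ℝ), ∑' n, Real.exp (-s * x) * da1Term α n x :=
      setIntegral_congr_fun measurableSet_Ioi fun x hx ↦
        ((hasSum_da1Term hα0 hx).mul_left _).tsum_eq.symm
    have hpow : 1 < s ^ α := Real.one_lt_rpow hs hα0
    rw [hD, hsum.unique hval, Real.rpow_neg hs0.le, Real.rpow_neg_one, Real.rpow_sub_one hs0.ne']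
    have h1 : 1 - (s ^ α)⁻¹ = (s ^ α - 1) / s ^ α := by field_simp
    have h2 : s ^ α - 1 ≠ 0 := by linarith
    rw [h1]
    field_simp
  · rw [← hint α hα0, ← hint 1 one_pos, ← integral_add (hki α hα0 n) (hki 1 one_pos n)]
    refine setIntegral_mono_on (integrableOn_exp_mul_da1Term hα0 hs0 n).norm
      ((hki α hα0 n).add (hki 1 one_pos n)) measurableSet_Ioi fun x hx ↦ ?_
    rw [hterm]
    refine (norm_sub_le _ _).trans_eq ?_
    rw [Real.norm_of_nonneg (hnn α hα0 n x hx), Real.norm_of_nonneg (hnn 1 one_pos n x hx)]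

theorem laplace_Da1 (α s : ℝ) (hα : α ∈ Set.Ioo (0:ℝ) 1) (hs : 0 < s) (hs1 : s ≠ 1) :
    ∫ x in Set.Ioi (0:ℝ), Real.exp (-s * x) * Da1 α x =
      (1 - s ^ (α - 1)) / (s ^ α - 1) := by
  have h := laplace_eq_of_eq_real (fun s hs ↦ integrableOn_exp_mul_Da1 hα hs)
    (differentiableOn_laplaceDa1 hα) (fun s hs ↦ by
      rw [laplace_Da1_of_one_lt hα hs, laplaceDa1_ofReal hα (by linarith) hs.ne'])
    (z := s) (by simpa using hs)
  rw [laplaceDa1_ofReal hα hs hs1] at h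
  have hcast : ∫ x in Set.Ioi (0 : ℝ), Complex.exp (-s * x) * Da1 α x =
      ((∫ x in Set.Ioi (0 : ℝ), Real.exp (-s * x) * Da1 α x : ℝ) : ℂ) := by
    rw [← integral_complex_ofReal]
    simp
  rw [hcast] at h
  exact_mod_cast h
end

section
/- For every α ∈ (0,1), there exists a positive random variable X_α (equivalently, a probability measure μ on (0,∞)) such that ∫_0^∞ x^s dμ(x) = Γ(1 + s/α) Γ(α) / Γ(α + s) for all s > −α. -/
open Real MeasureTheory

open ProbabilityTheory Filter Topology
open scoped ENNReal BoundedContinuousFunction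

lemma exists_isProbabilityMeasure_lintegral_exp_eq_div {a b : ℝ} (ha : 0 < a) (hab : a ≤ b) :
    ∃ κ : Measure ℝ, IsProbabilityMeasure κ ∧ ∀ s, -a < s →
      ∫⁻ x, ENNReal.ofReal (exp (s * x)) ∂κ =
        ENNReal.ofReal (a * (s + b) / (b * (s + a))) := by
  have hb : 0 < b := ha.trans_le hab
  have hq : 0 ≤ 1 - a / b := sub_nonneg.2 ((div_le_one hb).2 hab)
  let κ : Measure ℝ := ENNReal.ofReal (a / b) • Measure.dirac 0 +
    ENNReal.ofReal (1 - a / b) •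
      (volume.restrict (Set.Iic 0)).withDensity fun x ↦ ENNReal.ofReal (a * exp (a * x))
  have key (s : ℝ) (hs : -a < s) : ∫⁻ x, ENNReal.ofReal (exp (s * x)) ∂κ =
      ENNReal.ofReal (a * (s + b) / (b * (s + a))) := by
    have hsa : 0 < s + a := by linarith
    have h : ∫⁻ x, ENNReal.ofReal (exp (s * x))
        ∂(volume.restrict (Set.Iic 0)).withDensity
          (fun x ↦ ENNReal.ofReal (a * exp (a * x))) = ENNReal.ofReal (a / (s + a)) := by
      rw [lintegral_withDensity_eq_lintegral_mul _ (by fun_prop) (by fun_prop)]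
      have : ∀ x : ℝ, ((fun x ↦ ENNReal.ofReal (a * exp (a * x))) *
          fun x ↦ ENNReal.ofReal (exp (s * x))) x =
            ENNReal.ofReal (a * exp ((s + a) * x)) := fun x ↦ by
        rw [Pi.mul_apply, ← ENNReal.ofReal_mul (by positivity), mul_assoc, ← exp_add]
        ring_nf
      simp_rw [this]
      rw [← ofReal_integral_eq_lintegral_ofReal
        ((integrableOn_exp_mul_Iic hsa 0).const_mul a)
        (ae_of_all _ fun x ↦ by positivity), integral_const_mul, integral_exp_mul_Iic hsa]
      simp [div_eq_mul_inv]
    rw [lintegral_add_measure, lintegral_smul_measure, lintegral_smul_measure, h,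
      lintegral_dirac' _ (by fun_prop), mul_zero, exp_zero, smul_eq_mul, smul_eq_mul,
      ENNReal.ofReal_one, mul_one, ← ENNReal.ofReal_mul hq,
      ← ENNReal.ofReal_add (by positivity) (by positivity)]
    congr 1
    field_simp
    ring
  refine ⟨κ, ⟨?_⟩, key⟩
  have h0 := key 0 (by linarith)
  rw [show a * (0 + b) / (b * (0 + a)) = 1 by field_simp; ring] at h0
  simpa using h0

lemma exists_isProbabilityMeasure_lintegral_exp_eq_prod {α : ℝ} (hα : 0 < α) {a b : ℕ → ℝ}
    (ha : ∀ k, α ≤ a k) (hab : ∀ k, a k ≤ b k) (c : ℝ) (n : ℕ) :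
    ∃ ν : Measure ℝ, IsProbabilityMeasure ν ∧ ∀ s, -α < s →
      ∫⁻ x, ENNReal.ofReal (exp (s * x)) ∂ν =
        ENNReal.ofReal (exp (s * c) *
          ∏ k ∈ Finset.range n, a k * (s + b k) / (b k * (s + a k))) := by
  induction n with
  | zero => exact ⟨Measure.dirac c, inferInstance, fun s _ ↦ by
      rw [lintegral_dirac' _ (by fun_prop)]; simp⟩
  | succ n ih =>
    obtain ⟨ν, hν, hνs⟩ := ih
    have han : 0 < a n := hα.trans_le (ha n)
    obtain ⟨κ, hκ, hκs⟩ := exists_isProbabilityMeasure_lintegral_exp_eq_div han (hab n)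
    refine ⟨ν ∗ κ, inferInstance, fun s hs ↦ ?_⟩
    have hsa : -a n < s := by linarith [ha n]
    have hsb : 0 < s + b n := by linarith [hab n]
    have hbn : 0 < b n := han.trans_le (hab n)
    have hsa' : 0 < s + a n := by linarith
    rw [Measure.lintegral_conv (by fun_prop)]
    have hexp (x y : ℝ) : ENNReal.ofReal (exp (s * (x + y))) =
        ENNReal.ofReal (exp (s * x)) * ENNReal.ofReal (exp (s * y)) := by
      rw [mul_add, exp_add, ENNReal.ofReal_mul (exp_pos _).le]
    simp_rw [hexp, lintegral_const_mul' _ _ ENNReal.ofReal_ne_top]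
    rw [lintegral_mul_const _ (by fun_prop), hνs s hs, hκs s hsa, Finset.prod_range_succ,
      ← ENNReal.ofReal_mul' (by positivity), mul_assoc]

lemma exists_isProbabilityMeasure_mgf_eq_of_tendsto {α : ℝ} (hα : 0 < α) {ν : ℕ → Measure ℝ}
    [∀ n, IsProbabilityMeasure (ν n)] {M : ℝ → ℝ}
    (hint : ∀ n s, -α < s → Integrable (fun x ↦ exp (s * x)) (ν n))
    (hlim : ∀ s, -α < s → Tendsto (fun n ↦ ∫ x, exp (s * x) ∂ν n) atTop (𝓝 (M s))) :
    ∃ μ : Measure ℝ, IsProbabilityMeasure μ ∧ ∀ s, -α < s → ∫ x, exp (s * x) ∂μ = M s := by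
  have htight : IsTightMeasureSet (Set.range ν) := by
    obtain ⟨C, hC⟩ := (hlim (α / 2) (by linarith)).bddAbove_range
    obtain ⟨D, hD⟩ := (hlim (-(α / 2)) (by linarith)).bddAbove_range
    have hb (n : ℕ) (r : ℝ) :
        ν n {x | r < ‖x‖} ≤ ENNReal.ofReal (exp (-(α / 2) * r) * (C + D)) := by
      have hsub : {x : ℝ | r < ‖x‖} ⊆ {x | r ≤ id x} ∪ {x | id x ≤ -r} := fun x hx ↦ by
        rcases lt_abs.1 (show r < |x| from hx) with h | h
        · exact Or.inl h.le
        · exact Or.inr (show x ≤ -r by linarith)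
      rw [← ofReal_measureReal]
      refine ENNReal.ofReal_le_ofReal ((measureReal_mono hsub).trans
        ((measureReal_union_le _ _).trans ?_))
      have h1 := measure_ge_le_exp_mul_mgf (μ := ν n) (X := id) r (by positivity)
        (hint n (α / 2) (by linarith))
      have h2 := measure_le_le_exp_mul_mgf (μ := ν n) (X := id) (-r)
        (by linarith : -(α / 2) ≤ 0) (hint n (-(α / 2)) (by linarith))
      have h3 : mgf id (ν n) (α / 2) ≤ C := hC ⟨n, rfl⟩
      have h4 : mgf id (ν n) (-(α / 2)) ≤ D := hD ⟨n, rfl⟩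
      rw [show - -(α / 2) * -r = -(α / 2) * r by ring] at h2
      rw [mul_add]
      exact add_le_add (h1.trans (by gcongr)) (h2.trans (by gcongr))
    refine isTightMeasureSet_of_tendsto_measure_norm_gt ?_
    refine tendsto_of_tendsto_of_tendsto_of_le_of_le tendsto_const_nhds
      (h := fun r ↦ ENNReal.ofReal (exp (-(α / 2) * r) * (C + D))) ?_ (fun _ ↦ zero_le) ?_
    · rw [← ENNReal.ofReal_zero, ← zero_mul (C + D)]
      refine (ENNReal.continuous_ofReal.tendsto _).comp (Tendsto.mul_const _ ?_)
      exact tendsto_exp_atBot.comp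
        (tendsto_id.const_mul_atTop_of_neg (by linarith : -(α / 2) < 0))
    · intro r
      refine iSup₂_le ?_
      rintro _ ⟨n, rfl⟩
      exact hb n r
  let P : ℕ → ProbabilityMeasure ℝ := fun n ↦ ⟨ν n, inferInstance⟩
  have hcomp : IsCompact (closure (Set.range P)) := by
    refine isCompact_closure_of_isTightMeasureSet (htight.subset ?_)
    rintro _ ⟨_, ⟨n, rfl⟩, rfl⟩
    exact ⟨n, rfl⟩
  obtain ⟨μ, -, φ, hφ, hμ⟩ := hcomp.tendsto_subseq fun n ↦ subset_closure ⟨n, rfl⟩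
  rw [ProbabilityMeasure.tendsto_iff_forall_integral_tendsto] at hμ
  let T (s : ℝ) {K : ℝ} (hK : 0 ≤ K) : ℝ →ᵇ ℝ :=
    BoundedContinuousFunction.ofNormedAddCommGroup (fun x ↦ min (exp (s * x)) K)
      (by fun_prop) K (fun x ↦ by
        rw [norm_of_nonneg (le_min (exp_pos _).le hK)]; exact min_le_right _ _)
  have hTlim (s : ℝ) {K : ℝ} (hK : 0 ≤ K) :
      Tendsto (fun n ↦ ∫ x, min (exp (s * x)) K ∂ν (φ n)) atTop
        (𝓝 (∫ x, min (exp (s * x)) K ∂(μ : Measure ℝ))) := hμ (T s hK)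
  have hTint (s : ℝ) {K : ℝ} (hK : 0 ≤ K) (ρ : Measure ℝ) [IsProbabilityMeasure ρ] :
      Integrable (fun x ↦ min (exp (s * x)) K) ρ := (T s hK).integrable ρ
  have hlim' (s : ℝ) (hs : -α < s) :
      Tendsto (fun n ↦ ∫ x, exp (s * x) ∂ν (φ n)) atTop (𝓝 (M s)) :=
    (hlim s hs).comp hφ.tendsto_atTop
  have hle (s : ℝ) (hs : -α < s) {K : ℝ} (hK : 0 ≤ K) :
      ∫ x, min (exp (s * x)) K ∂(μ : Measure ℝ) ≤ M s :=
    le_of_tendsto_of_tendsto' (hTlim s hK) (hlim' s hs) fun n ↦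
      integral_mono (hTint s hK _) (hint _ s hs) fun x ↦ min_le_left _ _
  have hfatou (s : ℝ) (hs : -α < s) :
      ∫⁻ x, ENNReal.ofReal (exp (s * x)) ∂(μ : Measure ℝ) ≤ ENNReal.ofReal (M s) := by
    refine le_of_tendsto' (lintegral_tendsto_of_tendsto_of_monotone
      (f := fun (K : ℕ) x ↦ ENNReal.ofReal (min (exp (s * x)) K)) (fun K ↦ by fun_prop)
      (ae_of_all _ fun x K L hKL ↦ by dsimp only; gcongr) (ae_of_all _ fun x ↦ ?_)) fun K ↦ ?_
    · obtain ⟨N, hN⟩ := exists_nat_ge (exp (s * x))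
      refine tendsto_const_nhds.congr' ((eventually_ge_atTop N).mono fun K hK ↦ ?_)
      have hK' : (N : ℝ) ≤ K := by exact_mod_cast hK
      dsimp only
      rw [min_eq_left (hN.trans hK')]
    · rw [← ofReal_integral_eq_lintegral_ofReal (hTint s K.cast_nonneg _)
        (ae_of_all _ fun x ↦ le_min (exp_pos _).le K.cast_nonneg)]
      exact ENNReal.ofReal_le_ofReal (hle s hs K.cast_nonneg)
  have hμint (s : ℝ) (hs : -α < s) : Integrable (fun x ↦ exp (s * x)) (μ : Measure ℝ) := by
    refine (lintegral_ofReal_ne_top_iff_integrable (by fun_prop)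
      (ae_of_all _ fun x ↦ (exp_pos _).le)).1
      ((hfatou s hs).trans_lt ENNReal.ofReal_lt_top).ne
  refine ⟨μ, inferInstance, fun s hs ↦ le_antisymm ?_ ?_⟩
  · have hM : 0 ≤ M s := ge_of_tendsto' (hlim s hs) fun n ↦
      integral_nonneg fun x ↦ (exp_pos _).le
    have h := hfatou s hs
    rwa [← ofReal_integral_eq_lintegral_ofReal (hμint s hs)
      (ae_of_all _ fun x ↦ (exp_pos _).le), ENNReal.ofReal_le_ofReal_iff hM] at h
  · obtain ⟨ε, hε, hp⟩ : ∃ ε : ℝ, 0 < ε ∧ -α < s * (1 + ε) := by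
      refine ⟨(s + α) / (2 * (|s| + 1)), by have : 0 < s + α := by linarith
                                            positivity, ?_⟩
      have h1 : |s * ((s + α) / (2 * (|s| + 1)))| ≤ (s + α) / 2 := by
        have : 0 < s + α := by linarith
        rw [abs_mul, abs_of_pos (by positivity : 0 < (s + α) / (2 * (|s| + 1))), ← mul_div_assoc,
          div_le_div_iff₀ (by positivity) (by positivity)]
        nlinarith [abs_nonneg s]
      linarith [neg_abs_le (s * ((s + α) / (2 * (|s| + 1))))]
    have hpt {K : ℝ} (hK : 0 < K) (x : ℝ) :
        exp (s * x) ≤ min (exp (s * x)) K + exp (s * (1 + ε) * x) * K ^ (-ε) := by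
      rcases le_total (exp (s * x)) K with h | h
      · rw [min_eq_left h]
        exact le_add_of_nonneg_right (by positivity)
      · have h1 : 1 ≤ exp (s * x) ^ ε * K ^ (-ε) := by
          rw [rpow_neg hK.le, ← div_eq_mul_inv, ← div_rpow (exp_pos _).le hK.le]
          exact one_le_rpow ((one_le_div hK).2 h) hε.le
        have h2 : exp (s * (1 + ε) * x) = exp (s * x) * exp (s * x) ^ ε := by
          rw [← exp_mul, ← exp_add]
          ring_nf
        rw [h2, mul_assoc]
        exact (le_mul_of_one_le_right (exp_pos _).le h1).trans
          (le_add_of_nonneg_left (le_min (exp_pos _).le hK.le))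
    have hK {K : ℝ} (hK : 0 < K) :
        M s ≤ ∫ x, exp (s * x) ∂(μ : Measure ℝ) + M (s * (1 + ε)) * K ^ (-ε) := by
      have h1 : M s ≤ ∫ x, min (exp (s * x)) K ∂(μ : Measure ℝ) +
          M (s * (1 + ε)) * K ^ (-ε) := by
        refine le_of_tendsto_of_tendsto' (hlim' s hs)
          ((hTlim s hK.le).add ((hlim' _ hp).mul_const _)) fun n ↦ ?_
        rw [← integral_mul_const, ← integral_add (hTint s hK.le _) ((hint _ _ hp).mul_const _)]
        exact integral_mono (hint _ s hs)
          ((hTint s hK.le _).add ((hint _ _ hp).mul_const _)) (hpt hK)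
      exact h1.trans (add_le_add_left (integral_mono (hTint s hK.le _) (hμint s hs)
        fun x ↦ min_le_left _ _) _)
    have hlimK := ((tendsto_rpow_neg_atTop hε).const_mul (M (s * (1 + ε)))).const_add
      (∫ x, exp (s * x) ∂(μ : Measure ℝ))
    rw [mul_zero, add_zero] at hlimK
    exact ge_of_tendsto hlimK ((eventually_gt_atTop 0).mono fun K h ↦ hK h)

lemma GammaSeq_ratio_eq {α s : ℝ} (hα : 0 < α) (hs : -α < s) {n : ℕ} (hn : 0 < n) :
    GammaSeq (1 + s / α) n * GammaSeq α n / (GammaSeq 1 n * GammaSeq (α + s) n) =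
      exp (s * ((1 / α - 1) * log n)) * ∏ k ∈ Finset.range (n + 1),
        α * (1 + k) * (s + (α + k)) / ((α + k) * (s + α * (1 + k))) := by
  have hn' : (0 : ℝ) < n := by exact_mod_cast hn
  have hpow : (n : ℝ) ^ (1 + s / α) * (n : ℝ) ^ α / ((n : ℝ) ^ (1 : ℝ) * (n : ℝ) ^ (α + s)) =
      exp (s * ((1 / α - 1) * log n)) := by
    simp only [rpow_def_of_pos hn', ← exp_add, ← exp_sub]
    congr 1
    field_simp
    ring
  have hf : ((n.factorial : ℕ) : ℝ) ≠ 0 := by positivity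
  have hprod : (∏ k ∈ Finset.range (n + 1), α * (1 + k) * (s + (α + k)) /
        ((α + k) * (s + α * (1 + k)))) =
      (∏ k ∈ Finset.range (n + 1), (1 + (k : ℝ))) *
        (∏ k ∈ Finset.range (n + 1), (α + s + k)) /
        ((∏ k ∈ Finset.range (n + 1), (1 + s / α + k)) *
          ∏ k ∈ Finset.range (n + 1), (α + (k : ℝ))) := by
    simp only [← Finset.prod_mul_distrib, ← Finset.prod_div_distrib]
    refine Finset.prod_congr rfl fun k _ ↦ ?_
    have h1 : 0 < s + α * (1 + k) := by nlinarith [(k.cast_nonneg : (0 : ℝ) ≤ k)]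
    have h2 : 1 + s / α + k = (s + α * (1 + k)) / α := by field_simp; ring
    have h3 : 0 < α + k := by positivity
    rw [h2]
    field_simp
    ring
  rw [hprod, ← hpow]
  simp only [GammaSeq]
  have hp (x : ℝ) (hx : 0 < x) : ∏ k ∈ Finset.range (n + 1), (x + (k : ℝ)) ≠ 0 :=
    (Finset.prod_pos fun k _ ↦ by positivity).ne'
  have h1 := hp 1 one_pos
  have h2 := hp α hα
  have h3 := hp (α + s) (by linarith)
  have h4 := hp (1 + s / α) (by
    have := div_lt_div_of_pos_right hs hα
    rw [neg_div, div_self hα.ne'] at this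
    linarith)
  have h5 : (n : ℝ) ^ (α + s) ≠ 0 := by positivity
  have h6 : (n : ℝ) ^ (1 : ℝ) ≠ 0 := by positivity
  field_simp

lemma exists_isProbabilityMeasure_integral_exp_eq_Gamma {α : ℝ} (hα : 0 < α) (hα1 : α ≤ 1) :
    ∃ ν : Measure ℝ, IsProbabilityMeasure ν ∧ ∀ s, -α < s →
      ∫ x, exp (s * x) ∂ν = Gamma (1 + s / α) * Gamma α / Gamma (α + s) := by
  choose ν hν hνs using fun n : ℕ ↦ exists_isProbabilityMeasure_lintegral_exp_eq_prod hα
    (a := fun k ↦ α * (1 + k)) (b := fun k ↦ α + k)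
    (fun k ↦ by nlinarith [(k.cast_nonneg : (0 : ℝ) ≤ k)])
    (fun k ↦ by nlinarith [(k.cast_nonneg : (0 : ℝ) ≤ k)])
    ((1 / α - 1) * log n) (n + 1)
  refine exists_isProbabilityMeasure_mgf_eq_of_tendsto hα (ν := ν) (fun n s hs ↦ ?_)
    (fun s hs ↦ ?_)
  · refine (lintegral_ofReal_ne_top_iff_integrable (by fun_prop)
      (ae_of_all _ fun x ↦ (exp_pos _).le)).1 ?_
    rw [hνs n s hs]
    exact ENNReal.ofReal_ne_top
  · have hlim : Tendsto (fun n ↦ GammaSeq (1 + s / α) n * GammaSeq α n /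
        (GammaSeq 1 n * GammaSeq (α + s) n)) atTop
        (𝓝 (Gamma (1 + s / α) * Gamma α / Gamma (α + s))) := by
      have h := ((GammaSeq_tendsto_Gamma (1 + s / α)).mul (GammaSeq_tendsto_Gamma α)).div
        ((GammaSeq_tendsto_Gamma 1).mul (GammaSeq_tendsto_Gamma (α + s)))
        (by rw [Gamma_one, one_mul]; exact (Gamma_pos_of_pos (by linarith)).ne')
      rwa [Gamma_one, one_mul] at h
    refine hlim.congr' ((eventually_gt_atTop 0).mono fun n hn ↦ ?_)
    dsimp only
    rw [GammaSeq_ratio_eq hα hs hn, integral_eq_lintegral_of_nonneg_ae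
      (ae_of_all _ fun x ↦ (exp_pos _).le) (by fun_prop), hνs n s hs, ENNReal.toReal_ofReal]
    refine mul_nonneg (exp_pos _).le (Finset.prod_nonneg fun k _ ↦ ?_)
    have h1 : 0 < s + α * (1 + k) := by nlinarith [(k.cast_nonneg : (0 : ℝ) ≤ k)]
    have h2 : 0 < s + (α + k) := by linarith [(k.cast_nonneg : (0 : ℝ) ≤ k)]
    positivity

theorem exists_Xalpha (α : ℝ) (hα : α ∈ Set.Ioo (0:ℝ) 1) :
    ∃ μ : Measure ℝ, IsProbabilityMeasure μ ∧ μ {x | x ≤ 0} = 0 ∧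
      ∀ s : ℝ, -α < s →
        ∫ x in Set.Ioi (0:ℝ), x ^ s ∂μ =
          Real.Gamma (1 + s / α) * Real.Gamma α / Real.Gamma (α + s) := by
  obtain ⟨ν, hν, hνs⟩ := exists_isProbabilityMeasure_integral_exp_eq_Gamma hα.1 hα.2.le
  refine ⟨ν.map exp, Measure.isProbabilityMeasure_map (by fun_prop), ?_, fun s hs ↦ ?_⟩
  · rw [show {x : ℝ | x ≤ 0} = Set.Iic 0 from rfl,
      Measure.map_apply measurable_exp measurableSet_Iic]
    simp [Set.preimage, (exp_pos _).not_ge]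
  · rw [← hνs s hs, setIntegral_map measurableSet_Ioi
      (by fun_prop) (by fun_prop)]
    simp [Set.preimage, exp_pos, ← exp_mul, mul_comm]
end

section
/- For every α ∈ (0,1) and x > 0, e^x/α − E_α(x^α) = ∫_0^∞ e^{-xt} · sin(πα) t^{α−1} / (π(t^{2α} − 2cos(πα)t^α + 1)) dt. In particular, x ↦ e^x/α − E_α(x^α) is completely monotonic on (0,∞). -/
open Real MeasureTheory

/-- The Mittag-Leffler function evaluated at x^α : E_α(x^α) = ∑_{n≥0} x^{αn}/Γ(1+αn). -/
noncomputable def mlPow (α x : ℝ) : ℝ := ∑' n : ℕ, x ^ (α * n) / Real.Gamma (1 + α * n)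

/-- A function is completely monotonic on (0,∞). -/
def CompletelyMonotonicOn (f : ℝ → ℝ) : Prop :=
  ∀ n : ℕ, ∀ x : ℝ, 0 < x → 0 ≤ (-1 : ℝ) ^ n * iteratedDeriv n f x

open Filter Topology

/-! ### Uniqueness of the Laplace transform on `(0, ∞)` -/

section Uniqueness

open ProbabilityTheory

/-- Two finite measures on `ℝ` whose moment generating functions are finite and agree near `0`
are equal. -/
lemma ext_of_mgf_eventuallyEq {μ ν : Measure ℝ} [IsFiniteMeasure μ] [IsFiniteMeasure ν]
    (hμ : 0 ∈ interior (integrableExpSet id μ)) (hν : 0 ∈ interior (integrableExpSet id ν))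
    (h : mgf id μ =ᶠ[𝓝 0] mgf id ν) : μ = ν := by
  set A := interior (integrableExpSet id μ) ∩ interior (integrableExpSet id ν) with hA
  have hAconv : Convex ℝ A := convex_integrableExpSet.interior.inter convex_integrableExpSet.interior
  have hX : AnalyticOnNhd ℂ (complexMGF id μ) {z | z.re ∈ A} :=
    analyticOnNhd_complexMGF.mono fun z hz => hz.1
  have hY : AnalyticOnNhd ℂ (complexMGF id ν) {z | z.re ∈ A} :=
    analyticOnNhd_complexMGF.mono fun z hz => hz.2
  have hfreq : ∃ᶠ z in 𝓝[≠] (0 : ℂ), complexMGF id μ z = complexMGF id ν z := by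
    have hreal : ∃ᶠ x : ℝ in 𝓝[≠] (0 : ℝ), complexMGF id μ x = complexMGF id ν x := by
      refine Eventually.frequently ?_
      filter_upwards [nhdsWithin_le_nhds h] with x hx
      simp [complexMGF_ofReal, hx]
    have hlim : Tendsto (fun x : ℝ => (x : ℂ)) (𝓝[≠] 0) (𝓝[≠] (0 : ℂ)) := by
      refine tendsto_nhdsWithin_iff.2 ⟨?_, ?_⟩
      · simpa using (Complex.continuous_ofReal.tendsto 0).mono_left nhdsWithin_le_nhds
      · filter_upwards [self_mem_nhdsWithin] with x hx
        simpa using hx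
    exact hlim.frequently hreal
  have hEq := AnalyticOnNhd.eqOn_of_preconnected_of_frequently_eq hX hY
    (hAconv.linear_preimage Complex.reLm).isPreconnected (z₀ := 0) (by simp [hA, hμ, hν]) hfreq
  refine Measure.ext_of_charFun (funext fun t => ?_)
  rw [← complexMGF_id_mul_I, ← complexMGF_id_mul_I]
  exact hEq (by simp [hA, hμ, hν])

/-- The finite measure on `(0, ∞)` with density `exp (-2x) f x`. -/
noncomputable def tiltedMeasure (f : ℝ → ℝ) : Measure ℝ :=
  (volume.restrict (Set.Ioi 0)).withDensity fun x => ENNReal.ofReal (exp (-2 * x) * f x)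

variable {f g : ℝ → ℝ}

lemma aemeasurable_tilted_density (hf : ContinuousOn f (Set.Ioi 0)) :
    AEMeasurable (fun x => ENNReal.ofReal (exp (-2 * x) * f x)) (volume.restrict (Set.Ioi 0)) := by
  refine AEMeasurable.ennreal_ofReal (ContinuousOn.aemeasurable ?_ measurableSet_Ioi)
  fun_prop

lemma lintegral_tilted_density_lt_top
    (hfi : ∀ s, 1 < s → IntegrableOn (fun x => exp (-s * x) * f x) (Set.Ioi 0)) :
    ∫⁻ x in Set.Ioi 0, ENNReal.ofReal (exp (-2 * x) * f x) < ⊤ :=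
  (hfi 2 one_lt_two).lintegral_lt_top

lemma exp_mul_tilted_ae_eq (hf0 : ∀ x, 0 < x → 0 ≤ f x) (p : ℝ) :
    (fun x => (ENNReal.ofReal (exp (-2 * x) * f x)).toReal • exp (p * x))
      =ᵐ[volume.restrict (Set.Ioi 0)] fun x => exp (-(2 - p) * x) * f x := by
  filter_upwards [ae_restrict_mem measurableSet_Ioi] with x hx
  rw [ENNReal.toReal_ofReal (mul_nonneg (exp_pos _).le (hf0 x hx)), smul_eq_mul,
    mul_right_comm, ← exp_add]
  ring_nf

lemma Iio_subset_integrableExpSet_tiltedMeasure (hf : ContinuousOn f (Set.Ioi 0))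
    (hf0 : ∀ x, 0 < x → 0 ≤ f x)
    (hfi : ∀ s, 1 < s → IntegrableOn (fun x => exp (-s * x) * f x) (Set.Ioi 0)) :
    Set.Iio 1 ⊆ integrableExpSet id (tiltedMeasure f) := by
  intro p hp
  have hp' : p < 1 := hp
  rw [integrableExpSet, Set.mem_ofPred_eq, tiltedMeasure,
    integrable_withDensity_iff_integrable_smul₀' (aemeasurable_tilted_density hf) (by simp)]
  exact (hfi (2 - p) (by linarith)).congr (exp_mul_tilted_ae_eq hf0 p).symm

lemma mgf_tiltedMeasure (hf : ContinuousOn f (Set.Ioi 0)) (hf0 : ∀ x, 0 < x → 0 ≤ f x) (p : ℝ) :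
    mgf id (tiltedMeasure f) p = ∫ x in Set.Ioi 0, exp (-(2 - p) * x) * f x := by
  rw [mgf, tiltedMeasure,
    integral_withDensity_eq_integral_toReal_smul₀ (aemeasurable_tilted_density hf) (by simp)]
  exact integral_congr_ae (exp_mul_tilted_ae_eq hf0 p)

/-- Nonnegative continuous functions on `(0, ∞)` with the same Laplace transform on `(1, ∞)`
agree. -/
lemma eqOn_of_laplace_eq (hf : ContinuousOn f (Set.Ioi 0)) (hg : ContinuousOn g (Set.Ioi 0))
    (hf0 : ∀ x, 0 < x → 0 ≤ f x) (hg0 : ∀ x, 0 < x → 0 ≤ g x)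
    (hfi : ∀ s, 1 < s → IntegrableOn (fun x => exp (-s * x) * f x) (Set.Ioi 0))
    (hgi : ∀ s, 1 < s → IntegrableOn (fun x => exp (-s * x) * g x) (Set.Ioi 0))
    (h : ∀ s, 1 < s → ∫ x in Set.Ioi 0, exp (-s * x) * f x = ∫ x in Set.Ioi 0, exp (-s * x) * g x) :
    Set.EqOn f g (Set.Ioi 0) := by
  have hmem : (0 : ℝ) ∈ interior (Set.Iio (1 : ℝ)) := by simp
  have : IsFiniteMeasure (tiltedMeasure f) :=
    isFiniteMeasure_withDensity (lintegral_tilted_density_lt_top hfi).ne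
  have : IsFiniteMeasure (tiltedMeasure g) :=
    isFiniteMeasure_withDensity (lintegral_tilted_density_lt_top hgi).ne
  have hμν : tiltedMeasure f = tiltedMeasure g := by
    refine ext_of_mgf_eventuallyEq
      (interior_mono (Iio_subset_integrableExpSet_tiltedMeasure hf hf0 hfi) hmem)
      (interior_mono (Iio_subset_integrableExpSet_tiltedMeasure hg hg0 hgi) hmem) ?_
    filter_upwards [Iio_mem_nhds one_pos] with p hp
    have hp' : p < 1 := hp
    rw [mgf_tiltedMeasure hf hf0, mgf_tiltedMeasure hg hg0, h _ (by linarith)]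
  have hae := (withDensity_eq_iff (aemeasurable_tilted_density hf) (aemeasurable_tilted_density hg)
    (lintegral_tilted_density_lt_top hfi).ne).1 hμν
  refine Measure.eqOn_open_of_ae_eq (μ := volume) ?_ isOpen_Ioi hf hg
  filter_upwards [hae, ae_restrict_mem measurableSet_Ioi] with x hx hx0
  rw [ENNReal.ofReal_eq_ofReal_iff (mul_nonneg (exp_pos _).le (hf0 x hx0))
    (mul_nonneg (exp_pos _).le (hg0 x hx0))] at hx
  exact mul_left_cancel₀ (exp_pos _).ne' hx

end Uniqueness

/-! ### A residue formula for functions on a horizontal strip -/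

section Strip

/-- The open horizontal strip of half-width `2π`. -/
def wideStrip : Set ℂ := {w | |w.im| < 2 * π}

lemma isOpen_wideStrip : IsOpen wideStrip :=
  isOpen_lt (continuous_abs.comp Complex.continuous_im) continuous_const

lemma ofReal_mem_wideStrip (v : ℝ) : (v : ℂ) ∈ wideStrip := by
  simp [wideStrip, pi_pos]

lemma add_mul_I_mem_wideStrip {x y : ℝ} (hy : |y| ≤ π) : (x + y * Complex.I : ℂ) ∈ wideStrip := by
  have : |y| < 2 * π := by linarith [pi_pos]
  simpa [wideStrip] using this

lemma exp_ne_exp_of_mem_wideStrip {v : ℝ} {w : ℂ} (hw : w ∈ wideStrip) (hv : w ≠ v) :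
    Complex.exp w ≠ Complex.exp v := by
  intro h
  obtain ⟨n, hn⟩ := Complex.exp_eq_exp_iff_exists_int.1 h
  have him : w.im = n * (2 * π) := by simp [hn]
  have hw' : |w.im| < 2 * π := hw
  rw [him, abs_mul, abs_of_pos two_pi_pos, mul_lt_iff_lt_one_left two_pi_pos] at hw'
  have hn0 : n = 0 := by
    rw [← Int.cast_abs] at hw'
    exact Int.abs_lt_one_iff.1 (by exact_mod_cast hw')
  exact hv (by simpa [hn0] using hn)

lemma dslope_exp_ne_zero {v : ℝ} {w : ℂ} (hw : w ∈ wideStrip) :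
    dslope Complex.exp v w ≠ 0 := by
  rcases eq_or_ne w v with rfl | hv
  · simp [dslope_same]
  · rw [dslope_of_ne _ hv, slope_def_field]
    exact div_ne_zero (sub_ne_zero.2 (exp_ne_exp_of_mem_wideStrip hw hv)) (sub_ne_zero.2 hv)

lemma differentiableOn_dslope_div_dslope_exp {H : ℂ → ℂ} (hH : DifferentiableOn ℂ H wideStrip)
    (v : ℝ) :
    DifferentiableOn ℂ (fun w => dslope H v w / dslope Complex.exp v w) wideStrip := by
  have hnhds : wideStrip ∈ 𝓝 (v : ℂ) := isOpen_wideStrip.mem_nhds (ofReal_mem_wideStrip v)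
  exact ((Complex.differentiableOn_dslope hnhds).2 hH).div
    ((Complex.differentiableOn_dslope hnhds).2 Complex.differentiable_exp.differentiableOn)
    fun w hw => dslope_exp_ne_zero hw

lemma dslope_div_dslope_exp {H : ℂ → ℂ} {v : ℝ} {w : ℂ} (hv : w ≠ v) :
    dslope H v w / dslope Complex.exp v w = (H w - H v) / (Complex.exp w - Complex.exp v) := by
  rw [dslope_of_ne _ hv, dslope_of_ne _ hv, slope_def_field, slope_def_field,
    div_div_div_cancel_right₀ (sub_ne_zero.2 hv)]

/-- Integrals over vertical segments that escape to infinity inside a strip. -/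
lemma tendsto_integral_vertical {F : ℂ → ℂ} (hF : ContinuousOn F wideStrip) {l : Filter ℝ}
    [l.IsCountablyGenerated] {c : ℂ} (hc : Tendsto F (comap Complex.re l) (𝓝 c)) {p : ℝ → ℝ}
    (hp : Tendsto p atTop l) :
    Tendsto (fun R => ∫ y in (-π)..π, F (p R + y * Complex.I)) atTop (𝓝 (2 * π * c)) := by
  have hconst : ∫ _ in (-π)..π, c = 2 * π * c := by
    rw [intervalIntegral.integral_const, Complex.real_smul]
    push_cast
    ring
  rw [← hconst]
  have hlim (y : ℝ → ℝ) : Tendsto (fun R => F (p R + y R * Complex.I)) atTop (𝓝 c) := by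
    refine hc.comp (tendsto_comap_iff.2 (hp.congr fun R => ?_))
    simp
  have hbdd : ∀ᶠ R in atTop, ∀ y : ℝ, ‖F (p R + y * Complex.I)‖ ≤ ‖c‖ + 1 := by
    have hev : ∀ᶠ w : ℂ in comap Complex.re l, ‖F w‖ ≤ ‖c‖ + 1 :=
      (hc.norm.eventually_lt_const (lt_add_one _)).mono fun _ h => h.le
    rw [eventually_comap] at hev
    filter_upwards [hp.eventually hev] with R hR y
    exact hR _ (by simp)
  refine intervalIntegral.tendsto_integral_filter_of_dominated_convergence (fun _ => ‖c‖ + 1)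
    (Eventually.of_forall fun R => ?_) ?_ intervalIntegrable_const ?_
  · refine ContinuousOn.aestronglyMeasurable (hF.comp (by fun_prop) fun y hy => ?_)
      measurableSet_uIoc
    rw [Set.uIoc_of_le (by linarith [pi_pos])] at hy
    exact add_mul_I_mem_wideStrip (abs_le.2 ⟨hy.1.le, hy.2⟩)
  · filter_upwards [hbdd] with R hR
    exact Eventually.of_forall fun y _ => hR y
  · exact Eventually.of_forall fun y _ => hlim fun _ => y

lemma exp_sub_pi_mul_I (u : ℝ) :
    Complex.exp (u + (-π : ℝ) * Complex.I) = -Complex.exp u := by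
  rw [Complex.exp_add]
  push_cast
  rw [neg_mul, Complex.exp_neg, Complex.exp_pi_mul_I]
  norm_num

lemma exp_add_pi_mul_I (u : ℝ) :
    Complex.exp (u + π * Complex.I) = -Complex.exp u := by
  rw [Complex.exp_add, Complex.exp_pi_mul_I]
  ring

/-- A residue formula: the value of a function on a strip at a real point is determined by its
jump across the boundary. -/
lemma integral_jump_div_exp_add_exp {H : ℂ → ℂ} (hH : DifferentiableOn ℂ H wideStrip)
    (hbot : Tendsto H (comap Complex.re atBot) (𝓝 0)) {c : ℂ}
    (htop : Tendsto H (comap Complex.re atTop) (𝓝 c)) (v : ℝ) {J : ℝ → ℂ}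
    (hJ : ∀ u : ℝ, J u = (H (u + (-π : ℝ) * Complex.I) - H (u + π * Complex.I)) /
      (Complex.exp u + Complex.exp v))
    (hJi : Integrable J) :
    ∫ u, J u = -(2 * π * Complex.I * (H v / Complex.exp v)) := by
  set F : ℂ → ℂ := fun w => dslope H v w / dslope Complex.exp v w with hFdef
  have hF : DifferentiableOn ℂ F wideStrip := differentiableOn_dslope_div_dslope_exp hH v
  have hexp_bot := Complex.tendsto_exp_comap_re_atBot
  have hexp_top : Tendsto (fun w : ℂ => (Complex.exp w)⁻¹) (comap Complex.re atTop) (𝓝 0) :=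
    tendsto_inv₀_cobounded.comp Complex.tendsto_exp_comap_re_atTop
  have hv0 : Complex.exp v ≠ 0 := Complex.exp_ne_zero _
  have hne_bot : ∀ᶠ w : ℂ in comap Complex.re atBot, w ≠ v := by
    filter_upwards [tendsto_comap.eventually (eventually_lt_atBot v)] with w hw h
    simp [h] at hw
  have hne_top : ∀ᶠ w : ℂ in comap Complex.re atTop, w ≠ v := by
    filter_upwards [tendsto_comap.eventually (eventually_gt_atTop v)] with w hw h
    simp [h] at hw
  have hFbot : Tendsto F (comap Complex.re atBot) (𝓝 (H v / Complex.exp v)) := by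
    have := (hbot.sub_const (H v)).div (hexp_bot.sub_const (Complex.exp v)) (by simp)
    rw [zero_sub, zero_sub, neg_div_neg_eq] at this
    refine this.congr' ?_
    filter_upwards [hne_bot] with w hw
    simp only [hFdef, Pi.div_apply]
    rw [dslope_div_dslope_exp hw]
  have hFtop : Tendsto F (comap Complex.re atTop) (𝓝 0) := by
    have h1 : Tendsto (fun w : ℂ => 1 - Complex.exp v * (Complex.exp w)⁻¹) (comap Complex.re atTop)
        (𝓝 1) := by
      simpa using (hexp_top.const_mul (Complex.exp v)).const_sub 1
    have := ((htop.sub_const (H v)).mul hexp_top).div h1 one_ne_zero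
    rw [mul_zero, zero_div] at this
    refine this.congr' ?_
    filter_upwards [hne_top] with w hw
    simp only [hFdef, Pi.div_apply]
    rw [dslope_div_dslope_exp hw]
    have hw0 := Complex.exp_ne_zero w
    rw [← mul_div_mul_right (H w - H v) (Complex.exp w - Complex.exp v) (inv_ne_zero hw0),
      sub_mul (Complex.exp w), mul_inv_cancel₀ hw0]
  have hline (u : ℝ) : F (u + (-π : ℝ) * Complex.I) - F (u + π * Complex.I) = -J u := by
    have h1 : (u + (-π : ℝ) * Complex.I : ℂ) ≠ v := fun h => by
      have := congrArg Complex.im h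
      simp [pi_ne_zero] at this
    have h2 : (u + π * Complex.I : ℂ) ≠ v := fun h => by
      have := congrArg Complex.im h
      simp [pi_ne_zero] at this
    simp only [hFdef]
    rw [dslope_div_dslope_exp h1, dslope_div_dslope_exp h2, exp_sub_pi_mul_I, exp_add_pi_mul_I, hJ,
      ← sub_div, sub_sub_sub_cancel_right, ← div_neg]
    congr 1
    ring
  have hcont {y : ℝ} (hy : |y| ≤ π) (a b : ℝ) :
      IntervalIntegrable (fun u : ℝ => F (u + y * Complex.I)) volume a b :=
    (hF.continuousOn.comp (by fun_prop) fun u _ => add_mul_I_mem_wideStrip hy).intervalIntegrable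
  have hrect (R : ℝ) : -(∫ u in (-R)..R, J u) +
      Complex.I * (∫ y in (-π)..π, F ((R : ℝ) + y * Complex.I)) -
      Complex.I * (∫ y in (-π)..π, F ((-R : ℝ) + y * Complex.I)) = 0 := by
    have := Complex.integral_boundary_rect_eq_zero_of_differentiableOn F ⟨-R, -π⟩ ⟨R, π⟩
      (hF.mono fun w hw => by
        have h2 : w.im ∈ Set.uIcc (-π) π := hw.2
        rw [Set.uIcc_of_le (by linarith [pi_pos])] at h2
        have : |w.im| ≤ π := abs_le.2 h2
        change |w.im| < 2 * π
        linarith [pi_pos])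
    simp only [smul_eq_mul] at this
    rw [← intervalIntegral.integral_sub (hcont (by simp [abs_of_pos pi_pos]) _ _)
      (hcont (by simp [abs_of_pos pi_pos]) _ _)] at this
    simp only [hline] at this
    rwa [intervalIntegral.integral_neg] at this
  have hlim := ((intervalIntegral_tendsto_integral hJi tendsto_neg_atTop_atBot tendsto_id).neg.add
    ((tendsto_integral_vertical hF.continuousOn hFtop tendsto_id).const_mul Complex.I)).sub
    ((tendsto_integral_vertical hF.continuousOn hFbot tendsto_neg_atTop_atBot).const_mul Complex.I)
  have h0 := tendsto_nhds_unique (hlim.congr hrect) tendsto_const_nhds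
  linear_combination -h0

end Strip

/-! ### The spectral density and its Stieltjes transform -/

section Kernel

/-- The spectral density of `x ↦ exp x / α - E_α (x ^ α)`. -/
noncomputable def mlKernel (α t : ℝ) : ℝ :=
  sin (π * α) * t ^ (α - 1) / (π * (t ^ (2 * α) - 2 * cos (π * α) * t ^ α + 1))

variable {α : ℝ}

lemma sin_pi_mul_pos (hα : α ∈ Set.Ioo (0 : ℝ) 1) : 0 < sin (π * α) :=
  sin_pos_of_pos_of_lt_pi (mul_pos pi_pos hα.1) (mul_lt_of_lt_one_right pi_pos hα.2)

lemma mlKernel_denom_eq {t : ℝ} (ht : 0 ≤ t) :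
    t ^ (2 * α) - 2 * cos (π * α) * t ^ α + 1 = (t ^ α) ^ 2 - 2 * cos (π * α) * t ^ α + 1 := by
  rw [mul_comm 2 α, rpow_mul ht, rpow_two]

lemma sq_sin_le_mlKernel_denom {t : ℝ} (ht : 0 ≤ t) :
    sin (π * α) ^ 2 ≤ t ^ (2 * α) - 2 * cos (π * α) * t ^ α + 1 := by
  rw [mlKernel_denom_eq ht]
  nlinarith [sq_nonneg (t ^ α - cos (π * α)), sin_sq_add_cos_sq (π * α)]

lemma sq_sin_mul_rpow_le_mlKernel_denom {t : ℝ} (ht : 0 ≤ t) :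
    sin (π * α) ^ 2 * (t ^ α) ^ 2 ≤ t ^ (2 * α) - 2 * cos (π * α) * t ^ α + 1 := by
  rw [mlKernel_denom_eq ht, sin_sq]
  nlinarith [sq_nonneg (1 - cos (π * α) * t ^ α)]

lemma mlKernel_denom_pos (hα : α ∈ Set.Ioo (0 : ℝ) 1) {t : ℝ} (ht : 0 ≤ t) :
    0 < t ^ (2 * α) - 2 * cos (π * α) * t ^ α + 1 :=
  (pow_pos (sin_pi_mul_pos hα) 2).trans_le (sq_sin_le_mlKernel_denom ht)

lemma mlKernel_nonneg (hα : α ∈ Set.Ioo (0 : ℝ) 1) {t : ℝ} (ht : 0 < t) : 0 ≤ mlKernel α t := by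
  have := mlKernel_denom_pos hα ht.le
  have := sin_pi_mul_pos hα
  unfold mlKernel
  positivity

lemma mlKernel_le_rpow_sub_one (hα : α ∈ Set.Ioo (0 : ℝ) 1) {t : ℝ} (ht : 0 < t) :
    mlKernel α t ≤ (π * sin (π * α))⁻¹ * t ^ (α - 1) := by
  have hD := sq_sin_le_mlKernel_denom (α := α) ht.le
  have hs := sin_pi_mul_pos hα
  have ht' := rpow_pos_of_pos ht (α - 1)
  calc mlKernel α t ≤ sin (π * α) * t ^ (α - 1) / (π * sin (π * α) ^ 2) := by
        unfold mlKernel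
        gcongr
    _ = _ := by field_simp

lemma mlKernel_le_rpow_neg_sub_one (hα : α ∈ Set.Ioo (0 : ℝ) 1) {t : ℝ} (ht : 0 < t) :
    mlKernel α t ≤ (π * sin (π * α))⁻¹ * t ^ (-α - 1) := by
  have hD := sq_sin_mul_rpow_le_mlKernel_denom (α := α) ht.le
  have hs := sin_pi_mul_pos hα
  have ht' := rpow_pos_of_pos ht (α - 1)
  have hta := rpow_pos_of_pos ht α
  have hsplit : t ^ (-α - 1) = t ^ (α - 1) / (t ^ α) ^ 2 := by
    rw [← rpow_two, ← rpow_mul ht.le, ← rpow_sub ht]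
    ring_nf
  calc mlKernel α t ≤ sin (π * α) * t ^ (α - 1) / (π * (sin (π * α) ^ 2 * (t ^ α) ^ 2)) := by
        unfold mlKernel
        gcongr
    _ = _ := by
        rw [hsplit]
        field_simp

lemma continuousOn_mlKernel (hα : α ∈ Set.Ioo (0 : ℝ) 1) :
    ContinuousOn (mlKernel α) (Set.Ioi 0) := by
  have hrpow (p : ℝ) : ContinuousOn (fun t : ℝ => t ^ p) (Set.Ioi 0) :=
    fun t ht => (continuousAt_rpow_const t p (Or.inl (ne_of_gt ht))).continuousWithinAt
  refine ContinuousOn.div ((hrpow _).const_mul _)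
    ((((hrpow _).sub ((hrpow _).const_mul _)).add continuousOn_const).const_mul _) fun t ht => ?_
  exact (mul_pos pi_pos (mlKernel_denom_pos hα (le_of_lt ht))).ne'

lemma integrableOn_mlKernel (hα : α ∈ Set.Ioo (0 : ℝ) 1) :
    IntegrableOn (mlKernel α) (Set.Ioi 0) := by
  have hmeas : AEStronglyMeasurable (mlKernel α) (volume.restrict (Set.Ioi 0)) :=
    (continuousOn_mlKernel hα).aestronglyMeasurable measurableSet_Ioi
  have hnear : IntegrableOn (mlKernel α) (Set.Ioc 0 1) := by
    have hpow : IntegrableOn (fun t : ℝ => t ^ (α - 1)) (Set.Ioc 0 1) :=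
      (intervalIntegrable_iff_integrableOn_Ioc_of_le zero_le_one).1
        (intervalIntegral.intervalIntegrable_rpow' (by linarith [hα.1]))
    refine (hpow.const_mul (π * sin (π * α))⁻¹).mono'
      (hmeas.mono_measure (Measure.restrict_mono Set.Ioc_subset_Ioi_self le_rfl)) ?_
    filter_upwards [ae_restrict_mem measurableSet_Ioc] with t ht
    rw [norm_of_nonneg (mlKernel_nonneg hα ht.1)]
    exact mlKernel_le_rpow_sub_one hα ht.1
  have hfar : IntegrableOn (mlKernel α) (Set.Ioi 1) := by
    have hpow : IntegrableOn (fun t : ℝ => t ^ (-α - 1)) (Set.Ioi 1) :=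
      integrableOn_Ioi_rpow_of_lt (by linarith [hα.1]) one_pos
    refine (hpow.const_mul (π * sin (π * α))⁻¹).mono'
      (hmeas.mono_measure (Measure.restrict_mono (Set.Ioi_subset_Ioi zero_le_one) le_rfl)) ?_
    filter_upwards [ae_restrict_mem measurableSet_Ioi] with t ht
    have ht0 : 0 < t := one_pos.trans ht
    rw [norm_of_nonneg (mlKernel_nonneg hα ht0)]
    exact mlKernel_le_rpow_neg_sub_one hα ht0
  rw [← Set.Ioc_union_Ioi_eq_Ioi zero_le_one]
  exact hnear.union hfar

/-- In the coordinate `w = log s`, the Laplace transform of `E_α (x ^ α) - exp x / α`, times `s`. -/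
noncomputable def mlStrip (α : ℝ) (w : ℂ) : ℂ :=
  Complex.exp (α * w) / (Complex.exp (α * w) - 1) -
    Complex.exp w / (α * (Complex.exp w - 1))

lemma exists_differentiableOn_eq_mlStrip (hα : α ∈ Set.Ioo (0 : ℝ) 1) :
    ∃ H : ℂ → ℂ, DifferentiableOn ℂ H wideStrip ∧ ∀ w, w ≠ 0 → H w = mlStrip α w := by
  set ψ : ℂ → ℂ := fun z => Complex.exp z / dslope Complex.exp (0 : ℝ) z with hψ
  have hψd : DifferentiableOn ℂ ψ wideStrip := by
    have hnhds : wideStrip ∈ 𝓝 ((0 : ℝ) : ℂ) :=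
      isOpen_wideStrip.mem_nhds (ofReal_mem_wideStrip 0)
    exact Complex.differentiable_exp.differentiableOn.div
      ((Complex.differentiableOn_dslope hnhds).2 Complex.differentiable_exp.differentiableOn)
      fun w hw => dslope_exp_ne_zero hw
  have hψ_ne (z : ℂ) (hz : z ≠ 0) : ψ z = z * Complex.exp z / (Complex.exp z - 1) := by
    simp only [hψ, Complex.ofReal_zero]
    rw [dslope_of_ne _ hz, slope_def_field, Complex.exp_zero, sub_zero, div_div_eq_mul_div,
      mul_comm]
  have hmaps : Set.MapsTo (fun w : ℂ => α * w) wideStrip wideStrip := by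
    intro w hw
    have hw' : |w.im| < 2 * π := hw
    have : |(α * w : ℂ).im| = α * |w.im| := by
      rw [Complex.im_ofReal_mul, abs_mul, abs_of_pos hα.1]
    change |(α * w : ℂ).im| < 2 * π
    rw [this]
    nlinarith [abs_nonneg w.im, hα.1, hα.2]
  have hdiff : DifferentiableOn ℂ (fun w => ψ (α * w) - ψ w) wideStrip :=
    (hψd.comp (by fun_prop) hmaps).sub hψd
  refine ⟨fun w => (α : ℂ)⁻¹ * dslope (fun w => ψ (α * w) - ψ w) 0 w, ?_, fun w hw => ?_⟩
  · refine DifferentiableOn.const_mul ((Complex.differentiableOn_dslope ?_).2 hdiff) _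
    simpa using isOpen_wideStrip.mem_nhds (ofReal_mem_wideStrip 0)
  · have hα0 : (α : ℂ) ≠ 0 := by exact_mod_cast hα.1.ne'
    beta_reduce
    rw [dslope_of_ne _ hw, slope_def_field]
    simp only [mul_zero, sub_self, sub_zero]
    rw [hψ_ne _ hw, hψ_ne _ (mul_ne_zero hα0 hw), mlStrip]
    field_simp

lemma tendsto_mlStrip_atBot (hα : α ∈ Set.Ioo (0 : ℝ) 1) :
    Tendsto (mlStrip α) (comap Complex.re atBot) (𝓝 0) := by
  have hα0 : (α : ℂ) ≠ 0 := by exact_mod_cast hα.1.ne'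
  have h1 := Complex.tendsto_exp_comap_re_atBot
  have h2 : Tendsto (fun w : ℂ => Complex.exp (α * w)) (comap Complex.re atBot) (𝓝 0) := by
    refine h1.comp (tendsto_comap_iff.2 ?_)
    refine (tendsto_comap.const_mul_atBot hα.1).congr fun w => ?_
    simp
  have := (h2.div (h2.sub_const 1) (by simp)).sub
    (h1.div ((h1.sub_const 1).const_mul (α : ℂ)) (by simpa using hα0))
  simp only [zero_div, sub_zero] at this
  exact this

lemma tendsto_mlStrip_atTop (hα : α ∈ Set.Ioo (0 : ℝ) 1) :
    Tendsto (mlStrip α) (comap Complex.re atTop) (𝓝 (1 - (α : ℂ)⁻¹)) := by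
  have hα0 : (α : ℂ) ≠ 0 := by exact_mod_cast hα.1.ne'
  have h1 : Tendsto (fun w : ℂ => (Complex.exp w)⁻¹) (comap Complex.re atTop) (𝓝 0) :=
    tendsto_inv₀_cobounded.comp Complex.tendsto_exp_comap_re_atTop
  have h2 : Tendsto (fun w : ℂ => (Complex.exp (α * w))⁻¹) (comap Complex.re atTop) (𝓝 0) := by
    refine h1.comp (f := fun w : ℂ => α * w) (tendsto_comap_iff.2 ?_)
    refine (tendsto_comap.const_mul_atTop hα.1).congr fun w => ?_
    simp
  have := ((h2.const_sub 1).inv₀ (by simp)).sub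
    (((h1.const_sub 1).const_mul (α : ℂ)).inv₀ (by simpa using hα0))
  simp only [sub_zero, inv_one, mul_one] at this
  refine this.congr fun w => ?_
  have e1 := Complex.exp_ne_zero w
  have e2 := Complex.exp_ne_zero (α * w)
  rw [mlStrip, ← inv_div (Complex.exp (α * w) - 1), ← inv_div (α * (Complex.exp w - 1)),
    mul_div_assoc, sub_div, sub_div, div_self e1, div_self e2, one_div, one_div]

lemma mlStrip_jump (hα : α ∈ Set.Ioo (0 : ℝ) 1) (u : ℝ) :
    mlStrip α (u + (-π : ℝ) * Complex.I) - mlStrip α (u + π * Complex.I) =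
      2 * π * Complex.I * (exp u * mlKernel α (exp u) : ℝ) := by
  have hs := sin_pi_mul_pos hα
  set c := cos (π * α) with hc
  set d := sin (π * α) with hd
  set r := exp u ^ α with hr
  have hexp : (Complex.exp (α * u)) = r := by
    rw [hr, ← exp_mul]
    push_cast
    rw [mul_comm]
  have hp : Complex.exp (α * (u + π * Complex.I)) = r * (c + d * Complex.I) := by
    have : (α * (u + π * Complex.I) : ℂ) = α * u + (π * α : ℝ) * Complex.I := by
      push_cast
      ring
    rw [this, Complex.exp_add, hexp, Complex.exp_mul_I, hc, hd]
    push_cast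
    rfl
  have hm : Complex.exp (α * (u + (-π : ℝ) * Complex.I)) = r * (c - d * Complex.I) := by
    have : (α * (u + (-π : ℝ) * Complex.I) : ℂ) = α * u + (-(π * α) : ℝ) * Complex.I := by
      push_cast
      ring
    rw [this, Complex.exp_add, hexp, Complex.exp_mul_I, hc, hd, ← Complex.ofReal_cos,
      ← Complex.ofReal_sin, cos_neg, sin_neg]
    push_cast
    ring
  have hD : (0 : ℝ) < r ^ 2 - 2 * c * r + 1 := by
    have := mlKernel_denom_pos hα (exp_pos u).le
    rwa [mlKernel_denom_eq (exp_pos u).le] at this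
  have hDC : ((r : ℂ) ^ 2 - 2 * c * r + 1) ≠ 0 := by exact_mod_cast hD.ne'
  have hcd : (c : ℂ) ^ 2 + (d : ℂ) ^ 2 = 1 := by
    exact_mod_cast cos_sq_add_sin_sq (π * α)
  have hprod : (r * (c - d * Complex.I) - 1) * (r * (c + d * Complex.I) - 1) =
      (r : ℂ) ^ 2 - 2 * c * r + 1 := by
    linear_combination (r : ℂ) ^ 2 * hcd - (r : ℂ) ^ 2 * d ^ 2 * Complex.I_sq
  have hne := hDC
  rw [← hprod] at hne
  have hK : exp u * mlKernel α (exp u) = d * r / (π * (r ^ 2 - 2 * c * r + 1)) := by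
    rw [mlKernel, mlKernel_denom_eq (exp_pos u).le, rpow_sub_one (exp_pos u).ne']
    have := (exp_pos u).ne'
    rw [← hr, ← hc, ← hd]
    field_simp
  rw [mlStrip, mlStrip, exp_sub_pi_mul_I, exp_add_pi_mul_I, sub_sub_sub_cancel_right, hp, hm,
    div_sub_div _ _ (left_ne_zero_of_mul hne) (right_ne_zero_of_mul hne), hprod, hK]
  have hpi : (π : ℂ) ≠ 0 := by exact_mod_cast pi_ne_zero
  push_cast
  field_simp
  ring

lemma integrableOn_mlKernel_div_add (hα : α ∈ Set.Ioo (0 : ℝ) 1) {s : ℝ} (hs : 0 < s) :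
    IntegrableOn (fun t => mlKernel α t / (t + s)) (Set.Ioi 0) := by
  have hcont : ContinuousOn (fun t => mlKernel α t / (t + s)) (Set.Ioi 0) :=
    (continuousOn_mlKernel hα).div (by fun_prop) fun t ht => (add_pos ht hs).ne'
  refine ((integrableOn_mlKernel hα).div_const s).mono'
    (hcont.aestronglyMeasurable measurableSet_Ioi) ?_
  filter_upwards [ae_restrict_mem measurableSet_Ioi] with t ht
  have ht0 : 0 < t := ht
  have hK := mlKernel_nonneg hα ht0
  rw [norm_of_nonneg (by positivity)]
  gcongr
  linarith

/-- The Stieltjes transform of `mlKernel`. -/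
lemma integral_mlKernel_div_add (hα : α ∈ Set.Ioo (0 : ℝ) 1) {s : ℝ} (hs : 1 < s) :
    ∫ t in Set.Ioi 0, mlKernel α t / (t + s) = 1 / (α * (s - 1)) - s ^ α / (s * (s ^ α - 1)) := by
  have hs0 : 0 < s := one_pos.trans hs
  obtain ⟨H, hHd, hH⟩ := exists_differentiableOn_eq_mlStrip hα
  set g : ℝ → ℝ := fun t => mlKernel α t / (t + s) with hg
  have himage : exp '' Set.univ = Set.Ioi 0 := by rw [Set.image_univ, range_exp]
  have hderiv : ∀ u ∈ (Set.univ : Set ℝ), HasDerivWithinAt exp (exp u) Set.univ u :=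
    fun u _ => (hasDerivAt_exp u).hasDerivWithinAt
  have hint : ∫ t in Set.Ioi 0, g t = ∫ u, exp u * g (exp u) := by
    rw [← himage, integral_image_eq_integral_abs_deriv_smul MeasurableSet.univ hderiv
      exp_injective.injOn]
    simp
  have hintble : Integrable fun u => exp u * g (exp u) := by
    have := integrableOn_mlKernel_div_add hα hs0
    rw [← himage, integrableOn_image_iff_integrableOn_abs_deriv_smul MeasurableSet.univ hderiv
      exp_injective.injOn] at this
    simpa using this
  have hlog : Complex.exp (log s : ℝ) = s := by
    rw [← Complex.ofReal_exp, exp_log hs0]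
  have hpi_ne (u y : ℝ) (hy : y ≠ 0) : (u + y * Complex.I : ℂ) ≠ 0 := fun h => hy (by
    simpa using congrArg Complex.im h)
  have hbot : Tendsto H (comap Complex.re atBot) (𝓝 0) := by
    refine (tendsto_mlStrip_atBot hα).congr' ?_
    filter_upwards [tendsto_comap.eventually (eventually_lt_atBot 0)] with w hw
    exact (hH w fun h => by simp [h] at hw).symm
  have htop : Tendsto H (comap Complex.re atTop) (𝓝 (1 - (α : ℂ)⁻¹)) := by
    refine (tendsto_mlStrip_atTop hα).congr' ?_
    filter_upwards [tendsto_comap.eventually (eventually_gt_atTop 0)] with w hw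
    exact (hH w fun h => by simp [h] at hw).symm
  have key := integral_jump_div_exp_add_exp hHd hbot htop (log s)
    (J := fun u => 2 * π * Complex.I * (exp u * g (exp u) : ℝ))
    (fun u => by
      rw [hH _ (hpi_ne u _ (neg_ne_zero.2 pi_ne_zero)), hH _ (hpi_ne u _ pi_ne_zero),
        mlStrip_jump hα, hlog]
      simp only [hg]
      push_cast
      ring)
    (hintble.ofReal.const_mul _)
  rw [integral_const_mul, integral_complex_ofReal, ← hint, hlog, ← mul_neg] at key
  have hpi : (2 * π * Complex.I : ℂ) ≠ 0 := Complex.two_pi_I_ne_zero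
  have hval := mul_left_cancel₀ hpi key
  have hlog0 : ((log s : ℝ) : ℂ) ≠ 0 := by exact_mod_cast (log_pos hs).ne'
  have hpow : Complex.exp (α * (log s : ℝ)) = (s ^ α : ℝ) := by
    rw [rpow_def_of_pos hs0]
    push_cast
    rw [mul_comm]
  rw [hH _ hlog0, mlStrip, hlog, hpow] at hval
  have hreal : ∫ t in Set.Ioi 0, g t =
      -((s ^ α / (s ^ α - 1) - s / (α * (s - 1))) / s) := by
    exact_mod_cast hval
  rw [hreal, sub_div, neg_sub, div_div, div_div, mul_comm _ s, mul_comm _ s,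
    ← div_div s s, div_self hs0.ne']

end Kernel

/-! ### Laplace transforms of the spectral integral and of the Mittag-Leffler function -/

section SpectralIntegral

open ProbabilityTheory

variable {α : ℝ}

/-- The Laplace transform of `mlKernel`. -/
noncomputable def mlSpectral (α x : ℝ) : ℝ :=
  ∫ t in Set.Ioi 0, exp (-x * t) * mlKernel α t

/-- The measure on `(0, ∞)` with density `mlKernel`. -/
noncomputable def mlMeasure (α : ℝ) : Measure ℝ :=
  (volume.restrict (Set.Ioi 0)).withDensity fun t => ENNReal.ofReal (mlKernel α t)

lemma aemeasurable_mlMeasure_density (hα : α ∈ Set.Ioo (0 : ℝ) 1) :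
    AEMeasurable (fun t => ENNReal.ofReal (mlKernel α t)) (volume.restrict (Set.Ioi 0)) :=
  ((continuousOn_mlKernel hα).aemeasurable measurableSet_Ioi).ennreal_ofReal

lemma mlMeasure_density_smul_ae_eq (hα : α ∈ Set.Ioo (0 : ℝ) 1) (x : ℝ) :
    (fun t => (ENNReal.ofReal (mlKernel α t)).toReal • exp (x * -t))
      =ᵐ[volume.restrict (Set.Ioi 0)] fun t => exp (-x * t) * mlKernel α t := by
  filter_upwards [ae_restrict_mem measurableSet_Ioi] with t ht
  rw [ENNReal.toReal_ofReal (mlKernel_nonneg hα ht), smul_eq_mul, mul_comm, mul_neg, neg_mul]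

lemma integrableOn_exp_mul_mlKernel (hα : α ∈ Set.Ioo (0 : ℝ) 1) {x : ℝ} (hx : 0 < x) :
    IntegrableOn (fun t => exp (-x * t) * mlKernel α t) (Set.Ioi 0) := by
  have hcont : ContinuousOn (fun t => exp (-x * t) * mlKernel α t) (Set.Ioi 0) :=
    ContinuousOn.mul (by fun_prop) (continuousOn_mlKernel hα)
  refine (integrableOn_mlKernel hα).mono' (hcont.aestronglyMeasurable measurableSet_Ioi) ?_
  filter_upwards [ae_restrict_mem measurableSet_Ioi] with t ht
  have ht0 : 0 < t := ht
  rw [norm_of_nonneg (mul_nonneg (exp_pos _).le (mlKernel_nonneg hα ht))]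
  exact mul_le_of_le_one_left (mlKernel_nonneg hα ht) (exp_le_one_iff.2 (by nlinarith))

lemma mlSpectral_eq_mgf (hα : α ∈ Set.Ioo (0 : ℝ) 1) :
    mlSpectral α = mgf (fun t => -t) (mlMeasure α) := by
  funext x
  rw [mgf, mlMeasure, integral_withDensity_eq_integral_toReal_smul₀
    (aemeasurable_mlMeasure_density hα) (by simp)]
  exact (integral_congr_ae (mlMeasure_density_smul_ae_eq hα x)).symm

lemma mem_interior_integrableExpSet_mlMeasure (hα : α ∈ Set.Ioo (0 : ℝ) 1) {x : ℝ} (hx : 0 < x) :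
    x ∈ interior (integrableExpSet (fun t => -t) (mlMeasure α)) := by
  refine interior_maximal (s := integrableExpSet (fun t => -t) (mlMeasure α))
    (t := Set.Ioi 0) (fun y hy => ?_) isOpen_Ioi hx
  rw [integrableExpSet, Set.mem_ofPred_eq, mlMeasure,
    integrable_withDensity_iff_integrable_smul₀' (aemeasurable_mlMeasure_density hα) (by simp)]
  exact (integrableOn_exp_mul_mlKernel hα hy).congr (mlMeasure_density_smul_ae_eq hα y).symm

lemma continuousOn_mlSpectral (hα : α ∈ Set.Ioo (0 : ℝ) 1) :
    ContinuousOn (mlSpectral α) (Set.Ioi 0) := by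
  rw [mlSpectral_eq_mgf hα]
  exact continuousOn_mgf.mono fun x hx => mem_interior_integrableExpSet_mlMeasure hα hx

lemma mlSpectral_nonneg (hα : α ∈ Set.Ioo (0 : ℝ) 1) (x : ℝ) : 0 ≤ mlSpectral α x :=
  setIntegral_nonneg measurableSet_Ioi fun _ ht =>
    mul_nonneg (exp_pos _).le (mlKernel_nonneg hα ht)

lemma completelyMonotonicOn_mlSpectral (hα : α ∈ Set.Ioo (0 : ℝ) 1) :
    CompletelyMonotonicOn (mlSpectral α) := by
  intro n x hx
  rw [mlSpectral_eq_mgf hα, iteratedDeriv_mgf (mem_interior_integrableExpSet_mlMeasure hα hx),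
    ← integral_const_mul]
  refine integral_nonneg_of_ae ?_
  filter_upwards [(withDensity_absolutelyContinuous _ _).ae_le
    (ae_restrict_mem measurableSet_Ioi)] with t ht
  have ht0 : 0 < t := ht
  have : (-1 : ℝ) ^ n * ((-t) ^ n * exp (x * -t)) = t ^ n * exp (x * -t) := by
    rw [← mul_assoc, ← mul_pow, neg_one_mul, neg_neg]
  simp only [Pi.zero_apply]
  rw [this]
  positivity

lemma integrableOn_exp_neg_mul_Ioi {s : ℝ} (hs : 0 < s) :
    IntegrableOn (fun x => exp (-s * x)) (Set.Ioi 0) :=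
  integrableOn_exp_mul_Ioi (neg_lt_zero.2 hs) 0

lemma integral_exp_neg_mul_Ioi {s : ℝ} (hs : 0 < s) :
    ∫ x in Set.Ioi 0, exp (-s * x) = 1 / s := by
  rw [integral_exp_mul_Ioi (neg_lt_zero.2 hs)]
  simp

lemma integrable_laplace_mlSpectral_prod (hα : α ∈ Set.Ioo (0 : ℝ) 1) {s : ℝ} (hs : 0 < s) :
    Integrable (Function.uncurry fun x t => exp (-s * x) * (exp (-x * t) * mlKernel α t))
      ((volume.restrict (Set.Ioi 0)).prod (volume.restrict (Set.Ioi 0))) := by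
  have hprod := Integrable.mul_prod (integrableOn_exp_neg_mul_Ioi hs) (integrableOn_mlKernel hα)
  have hmeas : AEStronglyMeasurable (fun z : ℝ × ℝ => exp (-z.1 * z.2))
      ((volume.restrict (Set.Ioi 0)).prod (volume.restrict (Set.Ioi 0))) :=
    Continuous.aestronglyMeasurable (by fun_prop)
  refine hprod.mono ((hmeas.mul hprod.aestronglyMeasurable).congr ?_) ?_
  · exact Eventually.of_forall fun z => by
      simp only [Pi.mul_apply, Function.uncurry]
      ring
  · rw [Measure.prod_restrict]
    filter_upwards [ae_restrict_mem (measurableSet_Ioi.prod measurableSet_Ioi)] with z hz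
    have h1 : 0 < z.1 := hz.1
    have h2 : 0 < z.2 := hz.2
    have hle : exp (-z.1 * z.2) ≤ 1 := exp_le_one_iff.2 (by nlinarith)
    simp only [Function.uncurry, norm_mul, norm_eq_abs, abs_exp]
    gcongr
    exact mul_le_of_le_one_left (abs_nonneg _) hle

lemma integrableOn_laplace_mlSpectral (hα : α ∈ Set.Ioo (0 : ℝ) 1) {s : ℝ} (hs : 0 < s) :
    IntegrableOn (fun x => exp (-s * x) * mlSpectral α x) (Set.Ioi 0) := by
  refine (integrable_laplace_mlSpectral_prod hα hs).integral_prod_left.congr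
    (Eventually.of_forall fun x => ?_)
  simp only [Function.uncurry, mlSpectral]
  rw [integral_const_mul]

lemma laplace_mlSpectral (hα : α ∈ Set.Ioo (0 : ℝ) 1) {s : ℝ} (hs : 0 < s) :
    ∫ x in Set.Ioi 0, exp (-s * x) * mlSpectral α x =
      ∫ t in Set.Ioi 0, mlKernel α t / (t + s) := by
  simp only [mlSpectral, ← integral_const_mul]
  rw [integral_integral_swap (integrable_laplace_mlSpectral_prod hα hs)]
  refine setIntegral_congr_fun measurableSet_Ioi fun t ht => ?_
  have hts : 0 < t + s := add_pos ht hs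
  have hexp (x : ℝ) : exp (-s * x) * (exp (-x * t) * mlKernel α t) =
      exp (-(t + s) * x) * mlKernel α t := by
    rw [← mul_assoc, ← exp_add]
    ring_nf
  simp only [hexp]
  rw [integral_mul_const, integral_exp_neg_mul_Ioi hts, one_div_mul_eq_div]

end SpectralIntegral

section MittagLeffler

variable {α : ℝ}

lemma rpow_mul_exp_neg_le_Gamma {y M : ℝ} (hy : 0 ≤ y) (hM : 0 < M) :
    M ^ y * exp (-M) ≤ Gamma (1 + y) := by
  have hpos : 0 < 1 + y := by linarith
  have hconv := GammaIntegral_convergent hpos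
  have hsub : Set.Ioi M ⊆ Set.Ioi (0 : ℝ) := Set.Ioi_subset_Ioi hM.le
  rw [Gamma_eq_integral hpos, mul_comm]
  calc exp (-M) * M ^ y = ∫ x in Set.Ioi M, exp (-x) * M ^ y := by
        rw [integral_mul_const, integral_exp_neg_Ioi]
    _ ≤ ∫ x in Set.Ioi M, exp (-x) * x ^ (1 + y - 1) := by
        refine setIntegral_mono_on ((integrableOn_exp_neg_Ioi M).mul_const _)
          (hconv.mono_set hsub) measurableSet_Ioi fun x hx => ?_
        rw [add_sub_cancel_left]
        gcongr
        exact le_of_lt hx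
    _ ≤ ∫ x in Set.Ioi 0, exp (-x) * x ^ (1 + y - 1) := by
        refine setIntegral_mono_set hconv ?_ (Eventually.of_forall hsub)
        filter_upwards [ae_restrict_mem measurableSet_Ioi] with x hx
        exact mul_nonneg (exp_pos _).le (rpow_nonneg (le_of_lt hx) _)

lemma mlPow_term_nonneg (hα : 0 < α) (n : ℕ) {x : ℝ} (hx : 0 < x) :
    0 ≤ x ^ (α * n) / Gamma (1 + α * n) :=
  div_nonneg (rpow_nonneg hx.le _) (Gamma_pos_of_pos (by positivity)).le

lemma mlPow_term_le (hα : 0 < α) (n : ℕ) {x R : ℝ} (hx : 0 < x) (hxR : x ≤ R) :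
    x ^ (α * n) / Gamma (1 + α * n) ≤ exp (2 * R) * ((1 / 2 : ℝ) ^ α) ^ n := by
  have hR : 0 < R := hx.trans_le hxR
  have hy : 0 ≤ α * n := by positivity
  have hG := rpow_mul_exp_neg_le_Gamma hy (mul_pos two_pos hR)
  calc x ^ (α * n) / Gamma (1 + α * n) ≤ R ^ (α * n) / ((2 * R) ^ (α * n) * exp (-(2 * R))) := by
        gcongr
    _ = exp (2 * R) * ((1 / 2 : ℝ) ^ α) ^ n := by
        rw [← rpow_natCast, ← rpow_mul (by norm_num), mul_rpow two_pos.le hR.le, exp_neg,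
          div_rpow zero_le_one two_pos.le, one_rpow]
        have := (rpow_pos_of_pos hR (α * n)).ne'
        field_simp

lemma summable_mlPow_bound (hα : 0 < α) (R : ℝ) :
    Summable fun n : ℕ => exp (2 * R) * ((1 / 2 : ℝ) ^ α) ^ n :=
  (summable_geometric_of_lt_one (by positivity)
    (rpow_lt_one (by norm_num) (by norm_num) hα)).mul_left _

lemma mlPow_nonneg (hα : 0 < α) {x : ℝ} (hx : 0 < x) : 0 ≤ mlPow α x :=
  tsum_nonneg fun n => mlPow_term_nonneg hα n hx

lemma continuousOn_mlPow (hα : 0 < α) : ContinuousOn (mlPow α) (Set.Ioi 0) := by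
  intro x hx
  have hx0 : 0 < x := hx
  have hcont : ContinuousOn (mlPow α) (Set.Ioo 0 (x + 1)) := by
    refine continuousOn_tsum (fun n => ?_) (summable_mlPow_bound hα (x + 1)) fun n y hy => ?_
    · exact (continuousOn_id.rpow_const fun y hy => Or.inl (ne_of_gt hy.1)).div_const _
    · rw [norm_of_nonneg (mlPow_term_nonneg hα n hy.1)]
      exact mlPow_term_le hα n hy.1 hy.2.le
  exact (hcont.continuousAt (Ioo_mem_nhds hx0 (lt_add_one x))).continuousWithinAt

lemma laplace_mlPow_term (hα : 0 < α) (n : ℕ) {s : ℝ} (hs : 0 < s) :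
    ∫ x in Set.Ioi 0, exp (-s * x) * (x ^ (α * n) / Gamma (1 + α * n)) =
      s⁻¹ * ((s ^ α)⁻¹) ^ n := by
  have hpos : 0 < 1 + α * n := by positivity
  have hG : Gamma (1 + α * n) ≠ 0 := (Gamma_pos_of_pos hpos).ne'
  have hbase := integral_rpow_mul_exp_neg_mul_Ioi hpos hs
  have heq (x : ℝ) : exp (-s * x) * (x ^ (α * n) / Gamma (1 + α * n)) =
      x ^ (1 + α * n - 1) * exp (-(s * x)) * (Gamma (1 + α * n))⁻¹ := by
    rw [add_sub_cancel_left, neg_mul]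
    ring
  simp only [heq]
  rw [integral_mul_const, hbase, mul_inv_cancel_right₀ hG, one_div, inv_rpow hs.le,
    rpow_add hs, rpow_one, rpow_mul hs.le, rpow_natCast, mul_inv, inv_pow]

lemma laplace_mlPow (hα : 0 < α) {s : ℝ} (hs : 1 < s) :
    ∫ x in Set.Ioi 0, exp (-s * x) * mlPow α x = s ^ α / (s * (s ^ α - 1)) := by
  have hs0 : 0 < s := one_pos.trans hs
  have hsα : 1 < s ^ α := one_lt_rpow hs hα
  have hsα0 : 0 < s ^ α := one_pos.trans hsα
  have hgeom : HasSum (fun n : ℕ => s⁻¹ * ((s ^ α)⁻¹) ^ n) (s⁻¹ * (1 - (s ^ α)⁻¹)⁻¹) :=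
    (hasSum_geometric_of_lt_one (inv_nonneg.2 hsα0.le) (inv_lt_one_of_one_lt₀ hsα)).mul_left _
  have hterm (n : ℕ) := laplace_mlPow_term hα n hs0
  have hint (n : ℕ) : Integrable (fun x => exp (-s * x) * (x ^ (α * n) / Gamma (1 + α * n)))
      (volume.restrict (Set.Ioi 0)) := by
    refine Integrable.of_integral_ne_zero ?_
    rw [hterm]
    positivity
  have hnorm (n : ℕ) : ∫ x in Set.Ioi 0, ‖exp (-s * x) * (x ^ (α * n) / Gamma (1 + α * n))‖ =
      s⁻¹ * ((s ^ α)⁻¹) ^ n := by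
    rw [← hterm]
    refine setIntegral_congr_fun measurableSet_Ioi fun x hx => ?_
    exact norm_of_nonneg (mul_nonneg (exp_pos _).le (mlPow_term_nonneg hα n hx))
  have hsum := hasSum_integral_of_summable_integral_norm hint
    (by simpa only [hnorm] using hgeom.summable)
  simp only [hterm, tsum_mul_left] at hsum
  have hval := hsum.unique hgeom
  change ∫ x in Set.Ioi 0, exp (-s * x) * mlPow α x = _ at hval
  have : s ^ α - 1 ≠ 0 := by linarith
  rw [hval]
  field_simp

lemma integrableOn_laplace_mlPow (hα : 0 < α) {s : ℝ} (hs : 1 < s) :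
    IntegrableOn (fun x => exp (-s * x) * mlPow α x) (Set.Ioi 0) := by
  refine Integrable.of_integral_ne_zero ?_
  have hsα : 1 < s ^ α := one_lt_rpow hs hα
  rw [laplace_mlPow hα hs]
  exact (div_pos (by linarith) (mul_pos (by linarith) (by linarith))).ne'

/-- The spectral representation of the Mittag-Leffler function. -/
lemma exp_div_sub_mlPow_eq_mlSpectral (hα : α ∈ Set.Ioo (0 : ℝ) 1) {x : ℝ} (hx : 0 < x) :
    exp x / α - mlPow α x = mlSpectral α x := by
  have hα0 := hα.1
  have hexp (s y : ℝ) : exp (-s * y) * (exp y / α) = exp (-(s - 1) * y) * α⁻¹ := by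
    rw [← mul_div_assoc, ← exp_add, div_eq_mul_inv]
    ring_nf
  have hadd {s : ℝ} (hs : 1 < s) := (integrableOn_laplace_mlPow hα0 hs).add
    (integrableOn_laplace_mlSpectral hα (one_pos.trans hs))
  have key := eqOn_of_laplace_eq (f := fun y => mlPow α y + mlSpectral α y)
    (g := fun y => exp y / α)
    ((continuousOn_mlPow hα0).add (continuousOn_mlSpectral hα)) (by fun_prop)
    (fun y hy => add_nonneg (mlPow_nonneg hα0 hy) (mlSpectral_nonneg hα y))
    (fun y _ => by positivity)
    (fun s hs => by
      simp only [mul_add]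
      exact hadd hs)
    (fun s hs => by
      simp only [hexp]
      exact (integrableOn_exp_neg_mul_Ioi (sub_pos.2 hs)).mul_const _)
    (fun s hs => by
      simp only [hexp, mul_add]
      rw [integral_add (integrableOn_laplace_mlPow hα0 hs)
        (integrableOn_laplace_mlSpectral hα (one_pos.trans hs)), laplace_mlPow hα0 hs,
        laplace_mlSpectral hα (one_pos.trans hs), integral_mlKernel_div_add hα hs,
        integral_mul_const, integral_exp_neg_mul_Ioi (sub_pos.2 hs), add_sub_cancel, one_div,
        one_div, mul_inv, mul_comm])
  have := key hx
  simp only at this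
  linarith

end MittagLeffler

theorem exp_sub_ml_CM (α : ℝ) (hα : α ∈ Set.Ioo (0:ℝ) 1) :
    (∀ x : ℝ, 0 < x →
        Real.exp x / α - mlPow α x =
          ∫ t in Set.Ioi (0:ℝ), Real.exp (-x * t) *
            (Real.sin (Real.pi * α) * t ^ (α - 1) /
              (Real.pi * (t ^ (2 * α) - 2 * Real.cos (Real.pi * α) * t ^ α + 1)))) ∧
      CompletelyMonotonicOn (fun x => Real.exp x / α - mlPow α x) := by
  refine ⟨fun x hx => exp_div_sub_mlPow_eq_mlSpectral hα hx, fun n x hx => ?_⟩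
  have heq : (fun x => Real.exp x / α - mlPow α x) =ᶠ[𝓝 x] mlSpectral α := by
    filter_upwards [Ioi_mem_nhds hx] with y hy
    exact exp_div_sub_mlPow_eq_mlSpectral hα hy
  rw [heq.iteratedDeriv_eq n]
  exact completelyMonotonicOn_mlSpectral hα n x hx
end
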